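/- There exist a constant τ with 0 ≤ τ < 1 and, for each g ∈ Γ, a constant H_g ≥ 0 such that for all ξ, η ∈ ∂Γ one has |K(g,ξ) − K(g,η)| ≤ H_g · τ^{(ξ|η)}. (Hölder continuity of the Martin kernel on the Gromov boundary.) -/

import Mathlib

open Filter Topology MeasureTheory
open scoped ENNReal

namespace HarmonicBoundary

variable {Γ : Type} [Group Γ]

/-- Word length of `g` with respect to a generating set `S`. -/
noncomputable def wl (S : Set Γ) (g : Γ) : ℕ :=
  sInf {n : ℕ | ∃ w : List Γ, w.length = n ∧ (∀ x ∈ w, x ∈ S) ∧ w.prod = g}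

/-- Word metric `d(x,y) = |x⁻¹y|`. -/
noncomputable def wdist (S : Set Γ) (x y : Γ) : ℕ := wl S (x⁻¹ * y)

/-- Gromov product `(x|y)_z = (d(x,z)+d(y,z)-d(x,y))/2`. -/
noncomputable def gp (S : Set Γ) (z x y : Γ) : ℝ :=
  ((wdist S x z : ℝ) + (wdist S y z : ℝ) - (wdist S x y : ℝ)) / 2

/-- `S` is a finite symmetric generating set of `Γ`. -/
def IsGenSet (S : Set Γ) : Prop :=
  S.Finite ∧ (∀ s ∈ S, s⁻¹ ∈ S) ∧ Subgroup.closure S = ⊤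

/-- `Γ` is `δ`-hyperbolic with respect to the word metric of `S`:
`(x|y) ≥ min ((x|z), (y|z)) - δ` for all `x y z`. -/
def IsHyperbolic (S : Set Γ) (δ : ℝ) : Prop :=
  0 ≤ δ ∧ ∀ x y z : Γ, min (gp S 1 x z) (gp S 1 y z) - δ ≤ gp S 1 x y

/-- `Γ` is nonelementary: it has no cyclic subgroup of finite index. -/
def Nonelementary (Γ : Type) [Group Γ] : Prop :=
  ∀ g : Γ, (Subgroup.zpowers g).index = 0

/-- A sequence converges to infinity if `(x_i|x_j) → ∞`. -/
def ConvInf (S : Set Γ) (u : ℕ → Γ) : Prop :=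
  Tendsto (fun p : ℕ × ℕ => gp S 1 (u p.1) (u p.2)) atTop atTop

/-- Two sequences converging to infinity are equivalent if `(x_i|y_j) → ∞`. -/
def EquivSeq (S : Set Γ) (u v : ℕ → Γ) : Prop :=
  Tendsto (fun p : ℕ × ℕ => gp S 1 (u p.1) (v p.2)) atTop atTop

/-- An (abstract model of the) Gromov boundary of `Γ`: the points are exactly the
classes of sequences converging to infinity, modulo the equivalence `EquivSeq`,
together with the natural left action of `Γ`. -/
structure Boundary (Γ : Type) [Group Γ] (S : Set Γ) where
  pt : Type
  cls : (ℕ → Γ) → pt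
  cls_surj : ∀ ξ : pt, ∃ u : ℕ → Γ, ConvInf S u ∧ cls u = ξ
  cls_eq : ∀ u v : ℕ → Γ, ConvInf S u → ConvInf S v → (cls u = cls v ↔ EquivSeq S u v)
  smul : Γ → pt → pt
  smul_cls : ∀ (g : Γ) (u : ℕ → Γ), ConvInf S u → smul g (cls u) = cls fun n => g * u n

/-- Extension of the Gromov product to the boundary:
`(ξ|η) = sup liminf (x_i|y_j)` over sequences representing `ξ` and `η`,
as an extended nonnegative real. -/
noncomputable def bgp {S : Set Γ} (B : Boundary Γ S) (ξ η : B.pt) : ℝ≥0∞ :=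
  ⨆ (u : {u : ℕ → Γ // ConvInf S u ∧ B.cls u = ξ})
    (v : {v : ℕ → Γ // ConvInf S v ∧ B.cls v = η}),
    Filter.liminf (fun p : ℕ × ℕ => ENNReal.ofReal (gp S 1 (u.1 p.1) (v.1 p.2))) atTop

/-- Real-valued Gromov product on the boundary (finite for `ξ ≠ η`). -/
noncomputable def bgpR {S : Set Γ} (B : Boundary Γ S) (ξ η : B.pt) : ℝ := (bgp B ξ η).toReal

/-- The canonical topology of the Gromov boundary: a set is open iff around each of
its points it contains a basic neighbourhood `V_r(p) = {q | (q|p) > r}`. -/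
def btop {S : Set Γ} (B : Boundary Γ S) : TopologicalSpace B.pt where
  IsOpen O := ∀ p ∈ O, ∃ r : ℝ≥0∞, r ≠ ⊤ ∧ {q | r < bgp B q p} ⊆ O
  isOpen_univ := fun p _ => ⟨0, ENNReal.zero_ne_top, fun q _ => trivial⟩
  isOpen_inter := by
    intro A A' hA hA' p hp
    obtain ⟨r1, hr1, h1⟩ := hA p hp.1
    obtain ⟨r2, hr2, h2⟩ := hA' p hp.2
    refine ⟨max r1 r2, (max_lt hr1.lt_top hr2.lt_top).ne, fun q hq => ?_⟩
    have hq' : max r1 r2 < bgp B q p := hq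
    exact ⟨h1 (show r1 < bgp B q p from (le_max_left r1 r2).trans_lt hq'),
      h2 (show r2 < bgp B q p from (le_max_right r1 r2).trans_lt hq')⟩
  isOpen_sUnion := by
    intro s hs p hp
    obtain ⟨t, ht, hpt⟩ := hp
    obtain ⟨r, hr, hsub⟩ := hs t ht p hpt
    exact ⟨r, hr, fun q hq => ⟨t, ht, hsub hq⟩⟩

/-- The attracting fixed point `g⁺ = lim_n gⁿ` of an (infinite order) element. -/
def plusPt {S : Set Γ} (B : Boundary Γ S) (g : Γ) : B.pt := B.cls fun n => g ^ n

/-- The repelling fixed point `g⁻ = lim_n g⁻ⁿ` of an (infinite order) element. -/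
def minusPt {S : Set Γ} (B : Boundary Γ S) (g : Γ) : B.pt := B.cls fun n => g⁻¹ ^ n

/-- A geodesic ray starting at the identity. -/
def IsGeodesicRay (S : Set Γ) (x : ℕ → Γ) : Prop :=
  x 0 = 1 ∧ ∀ m n : ℕ, wdist S (x m) (x n) = Nat.dist m n

/-- A geodesic ray from `e` to the boundary point `ξ`, i.e. an element of `[e,ξ]`. -/
def RayTo {S : Set Γ} (B : Boundary Γ S) (x : ℕ → Γ) (ξ : B.pt) : Prop :=
  IsGeodesicRay S x ∧ ConvInf S x ∧ B.cls x = ξ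

/-- A geodesic segment from `x` to `y` (parametrized on `0,…,d(x,y)`),
i.e. an element of `[x,y]`. -/
def IsGeodesicSeg (S : Set Γ) (x y : Γ) (α : ℕ → Γ) : Prop :=
  α 0 = x ∧ α (wdist S x y) = y ∧
  ∀ m n : ℕ, m ≤ wdist S x y → n ≤ wdist S x y → wdist S (α m) (α n) = Nat.dist m n

/-- The boundary "cylinder" `U(ξ,R)`: all `η` such that for every pair of geodesic
rays `x ∈ [e,ξ]`, `y ∈ [e,η]` one has `lim_n (x(n)|y(n)) > R` (the sequence
`(x(n)|y(n))` is nondecreasing, so the limit exceeds `R` iff some term does). -/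
def Uset {S : Set Γ} (B : Boundary Γ S) (ξ : B.pt) (R : ℝ) : Set B.pt :=
  {η | ∀ x y : ℕ → Γ, RayTo B x ξ → RayTo B y η → ∃ n : ℕ, R < gp S 1 (x n) (y n)}

/-- `C_r(p) = {g | (g|e)_p > r}`. -/
def Cset (S : Set Γ) (p : Γ) (r : ℝ) : Set Γ := {g | r < gp S p g 1}

/-- The `R`-neighbourhood `N(α,R)` of a geodesic segment `α ∈ [x,y]`. -/
def segN (S : Set Γ) (x y : Γ) (α : ℕ → Γ) (R : ℝ) : Set Γ :=
  {g | ∃ i ≤ wdist S x y, (wdist S g (α i) : ℝ) ≤ R}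

/-- The `R`-neighbourhood `N(A,R)` of a subset `A ⊆ Γ`. -/
def setN (S : Set Γ) (A : Set Γ) (R : ℝ) : Set Γ :=
  {g | ∃ a ∈ A, (wdist S g a : ℝ) ≤ R}

/-- `μ` is a nondegenerate probability measure on `Γ` with support contained in `S`:
nonnegative, of total mass one, supported in `S`, and the semigroup generated by its
support is the whole of `Γ`. -/
structure IsRWMeasure (S : Set Γ) (μ : Γ → ℝ) : Prop where
  nonneg : ∀ g, 0 ≤ μ g
  support_subset : ∀ g, μ g ≠ 0 → g ∈ S
  total : ∑' g : Γ, μ g = 1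
  nondeg : ∀ g : Γ, ∃ l : List Γ, l ≠ [] ∧ (∀ x ∈ l, 0 < μ x) ∧ l.prod = g

open Classical in
/-- `n`-step transition probabilities `p⁽ⁿ⁾(x,y) = μ*ⁿ(x⁻¹y)` of the random walk. -/
noncomputable def ptrans (μ : Γ → ℝ) : ℕ → Γ → Γ → ℝ
  | 0 => fun x y => if x = y then 1 else 0
  | n + 1 => fun x y => ∑' z : Γ, ptrans μ n x z * μ (z⁻¹ * y)

/-- Green function `G(x,y) = Σ_n p⁽ⁿ⁾(x,y)`. -/
noncomputable def green (μ : Γ → ℝ) (x y : Γ) : ℝ := ∑' n : ℕ, ptrans μ n x y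

/-- `F(x,y) = G(x,y)/G(y,y)`, the probability that the walk from `x` ever hits `y`. -/
noncomputable def greenF (μ : Γ → ℝ) (x y : Γ) : ℝ := green μ x y / green μ y y

/-- The Martin kernel `K(x,y) = G(x,y)/G(e,y)`. -/
noncomputable def martinK (μ : Γ → ℝ) (x y : Γ) : ℝ := green μ x y / green μ 1 y

open Classical in
/-- Transition probabilities of the walk restricted to `Δ` (killed when leaving `Δ`). -/
noncomputable def ptransR (μ : Γ → ℝ) (Δ : Set Γ) : ℕ → Γ → Γ → ℝ
  | 0 => fun x y => if x = y ∧ x ∈ Δ then 1 else 0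
  | n + 1 => fun x y => if y ∈ Δ then ∑' z : Γ, ptransR μ Δ n x z * μ (z⁻¹ * y) else 0

/-- Green function `G_Δ` of the restricted walk. -/
noncomputable def greenR (μ : Γ → ℝ) (Δ : Set Γ) (x y : Γ) : ℝ := ∑' n : ℕ, ptransR μ Δ n x y

/-- `F_Δ(x,y) = G_Δ(x,y)/G_Δ(y,y)`. -/
noncomputable def greenFR (μ : Γ → ℝ) (Δ : Set Γ) (x y : Γ) : ℝ :=
  greenR μ Δ x y / greenR μ Δ y y

/-- Generating function `G_Δ(x,y|z) = Σ_n p_Δ⁽ⁿ⁾(x,y) zⁿ`. -/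
noncomputable def greenRZ (μ : Γ → ℝ) (Δ : Set Γ) (x y : Γ) (z : ℝ) : ℝ :=
  ∑' n : ℕ, ptransR μ Δ n x y * z ^ n

/-- Spectral radius `ρ(P) = lim_n p⁽ⁿ⁾(e,e)^{1/n}` of the walk. -/
noncomputable def specRad (μ : Γ → ℝ) : ℝ :=
  Filter.limsup (fun n : ℕ => (ptrans μ n 1 1) ^ ((n : ℝ)⁻¹)) atTop

/-- `u` is harmonic on `Λ`: `Σ_h p(g,h) u(h) = u(g)` for `g ∈ Λ`, `p(g,h)=μ(g⁻¹h)`. -/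
def HarmonicOn (μ : Γ → ℝ) (u : Γ → ℝ) (Λ : Set Γ) : Prop :=
  ∀ g ∈ Λ, (∑' h : Γ, μ (g⁻¹ * h) * u h) = u g

/-- `u` vanishes at infinity on `Λ`: `u(g_n) → 0` along sequences in `Λ` with `|g_n|→∞`. -/
def VanishesAtInftyOn (S : Set Γ) (u : Γ → ℝ) (Λ : Set Γ) : Prop :=
  ∀ ε : ℝ, 0 < ε → ∃ M : ℕ, ∀ g ∈ Λ, M ≤ wl S g → |u g| ≤ ε

open Classical in
/-- `r(g) = K(g⁻¹,g⁺)` for infinite order `g`, and `r(g) = 1` for finite order `g`;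
here `Kb` is the boundary extension of the Martin kernel. -/
noncomputable def rfun {S : Set Γ} (B : Boundary Γ S) (Kb : Γ → B.pt → ℝ) (g : Γ) : ℝ :=
  if IsOfFinOrder g then 1 else Kb g⁻¹ (plusPt B g)

/-- The ratio set `r(Γ,∂Γ,ν)`: all `l ≥ 0` such that for every `ε > 0` and every
Borel `A` of positive measure there is `g ∈ Γ` such that
`{ω ∈ gA ∩ A : |d(gν)/dν(ω) − l| < ε}` has positive measure; here the
Radon–Nikodym derivative `d(gν)/dν` is the Martin kernel `Kb g`. -/
def ratioSet {S : Set Γ} (B : Boundary Γ S) [MeasurableSpace B.pt]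
    (ν : Measure B.pt) (Kb : Γ → B.pt → ℝ) : Set ℝ :=
  {l : ℝ | 0 ≤ l ∧ ∀ ε : ℝ, 0 < ε → ∀ A : Set B.pt, MeasurableSet A → 0 < ν A →
    ∃ g : Γ, 0 < ν {ω | ω ∈ A ∧ B.smul g⁻¹ ω ∈ A ∧ |Kb g ω - l| < ε}}

/-- A left invariant finitely additive mean on `Γ`; `Γ` is amenable iff one exists. -/
structure InvariantMean (Γ : Type) [Group Γ] where
  m : Set Γ → ℝ
  nonneg : ∀ A, 0 ≤ m A
  total : m Set.univ = 1
  fin_add : ∀ A B : Set Γ, Disjoint A B → m (A ∪ B) = m A + m B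
  invariant : ∀ (g : Γ) (A : Set Γ), m ((g * ·) ⁻¹' A) = m A


/-! ### Kernels with values in `[0,∞]` -/

/-- Kernels on a set `V`. -/
def Ker (V : Type) : Type := V → V → ℝ≥0∞

namespace Ker
variable {V : Type}

noncomputable instance : AddCommMonoid (Ker V) := inferInstanceAs (AddCommMonoid (V → V → ℝ≥0∞))
instance : PartialOrder (Ker V) := inferInstanceAs (PartialOrder (V → V → ℝ≥0∞))

noncomputable instance : Mul (Ker V) := ⟨fun p q x y => ∑' z, p x z * q z y⟩
open Classical in
noncomputable instance : One (Ker V) := ⟨fun x y => if x = y then 1 else 0⟩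

theorem mul_app (p q : Ker V) (x y : V) : (p * q) x y = ∑' z, p x z * q z y := rfl
open Classical in
theorem one_app (x y : V) : (1 : Ker V) x y = if x = y then 1 else 0 := rfl
theorem add_app (p q : Ker V) (x y : V) : (p + q) x y = p x y + q x y := rfl
theorem zero_app (x y : V) : (0 : Ker V) x y = 0 := rfl
theorem le_def (p q : Ker V) : p ≤ q ↔ ∀ x y, p x y ≤ q x y := Iff.rfl

@[ext] theorem ext {p q : Ker V} (h : ∀ x y, p x y = q x y) : p = q := funext fun x => funext fun y => h x y

protected theorem one_mul' (p : Ker V) : 1 * p = p := by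
  classical
  ext x y
  rw [mul_app, tsum_eq_single x]
  · simp [one_app]
  · intro z hz; simp [one_app, Ne.symm hz]

protected theorem mul_one' (p : Ker V) : p * 1 = p := by
  classical
  ext x y
  rw [mul_app, tsum_eq_single y]
  · simp [one_app]
  · intro z hz; simp [one_app, hz]

protected theorem mul_assoc' (p q r : Ker V) : p * q * r = p * (q * r) := by
  ext x y
  simp only [mul_app, ← ENNReal.tsum_mul_right, ← ENNReal.tsum_mul_left]
  rw [ENNReal.tsum_comm]
  simp only [mul_assoc]

noncomputable instance : Semiring (Ker V) :=
  { (inferInstance : AddCommMonoid (Ker V)) with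
    mul := (· * ·)
    one := 1
    left_distrib := fun p q r => by
      ext x y; simp only [mul_app, add_app, mul_add, ENNReal.tsum_add]
    right_distrib := fun p q r => by
      ext x y; simp only [mul_app, add_app, add_mul, ENNReal.tsum_add]
    zero_mul := fun p => by ext x y; simp [mul_app, zero_app]
    mul_zero := fun p => by ext x y; simp [mul_app, zero_app]
    mul_assoc := Ker.mul_assoc'
    one_mul := Ker.one_mul'
    mul_one := Ker.mul_one' }

theorem mul_mono {p p' q q' : Ker V} (h : p ≤ p') (h' : q ≤ q') : p * q ≤ p' * q' :=
  fun x y => ENNReal.tsum_le_tsum fun z => mul_le_mul' (h x z) (h' z y)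

theorem add_mono {p p' q q' : Ker V} (h : p ≤ p') (h' : q ≤ q') : p + q ≤ p' + q' :=
  fun x y => add_le_add (h x y) (h' x y)

theorem pow_mono {p q : Ker V} (h : p ≤ q) (n : ℕ) : p ^ n ≤ q ^ n := by
  induction n with
  | zero => simp
  | succ n ih => rw [pow_succ, pow_succ]; exact mul_mono ih h

/-- Green kernel. -/
noncomputable def Gr (p : Ker V) : Ker V := fun x y => ∑' n : ℕ, (p ^ n) x y

theorem Gr_app (p : Ker V) (x y : V) : Gr p x y = ∑' n : ℕ, (p ^ n) x y := rfl

theorem Gr_mono {p q : Ker V} (h : p ≤ q) : Gr p ≤ Gr q :=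
  fun x y => ENNReal.tsum_le_tsum fun n => pow_mono h n x y

theorem pow_le_Gr (p : Ker V) (n : ℕ) : p ^ n ≤ Gr p := fun x y => ENNReal.le_tsum (f := fun n => (p ^ n) x y) n

theorem sum_app (s : Finset ℕ) (x y : V) (f : ℕ → Ker V) :
    (∑ n ∈ s, f n) x y = ∑ n ∈ s, f n x y := by
  classical
  induction s using Finset.induction_on with
  | empty => rfl
  | insert a s ha ih => rw [Finset.sum_insert ha, Finset.sum_insert ha, add_app, ih]

theorem Gr_mul (p q : Ker V) (x y : V) : (Gr p * q) x y = ∑' n : ℕ, (p ^ n * q) x y := by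
  simp only [mul_app, Gr_app, ← ENNReal.tsum_mul_right]
  exact ENNReal.tsum_comm

theorem mul_Gr (p q : Ker V) (x y : V) : (q * Gr p) x y = ∑' n : ℕ, (q * p ^ n) x y := by
  simp only [mul_app, Gr_app, ← ENNReal.tsum_mul_left]
  exact ENNReal.tsum_comm

theorem Gr_eq (p : Ker V) : Gr p = 1 + p * Gr p := by
  ext x y
  rw [add_app, mul_Gr, Gr_app, tsum_eq_zero_add' ENNReal.summable, pow_zero]
  simp only [pow_succ']

theorem Gr_eq' (p : Ker V) : Gr p = 1 + Gr p * p := by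
  ext x y
  rw [add_app, Gr_mul, Gr_app, tsum_eq_zero_add' ENNReal.summable, pow_zero]
  simp only [pow_succ]

theorem Gr_mul_le {p g X : Ker V} (h : g + p * X ≤ X) : Gr p * g ≤ X := by
  intro x y
  rw [Gr_mul]
  refine ENNReal.tsum_le_of_sum_range_le fun n => ?_
  have key : ∀ n : ℕ, ∑ k ∈ Finset.range n, (p ^ k * g) ≤ X := by
    intro n
    induction n with
    | zero => intro x y; simp [zero_app]
    | succ n ih =>
      rw [Finset.sum_range_succ', pow_zero, one_mul, add_comm]
      have : ∑ k ∈ Finset.range n, p ^ (k + 1) * g = p * ∑ k ∈ Finset.range n, (p ^ k * g) := by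
        rw [Finset.mul_sum]; simp only [pow_succ', mul_assoc]
      rw [this]
      exact (add_mono le_rfl (mul_mono le_rfl ih)).trans h
  have := key n x y
  rwa [sum_app] at this

theorem Gr_le {p X : Ker V} (h : 1 + p * X ≤ X) : Gr p ≤ X := by
  have := Gr_mul_le h
  rwa [mul_one] at this

/-- Resolvent identity. -/
theorem resolvent {p a b : Ker V} (h : p = a + b) : Gr p = Gr a + Gr a * b * Gr p := by
  apply le_antisymm
  · intro x y
    rw [Gr_app]
    refine ENNReal.tsum_le_of_sum_range_le fun n => ?_
    have key : ∀ n : ℕ, ∑ k ∈ Finset.range n, p ^ k ≤ Gr a + Gr a * b * Gr p := by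
      intro n
      induction n with
      | zero => intro x y; simp [zero_app]
      | succ n ih =>
        have h1 : ∑ k ∈ Finset.range n, p ^ k ≤ Gr p := by
          intro x y
          rw [sum_app]
          exact ENNReal.sum_le_tsum _
        rw [Finset.sum_range_succ', pow_zero, add_comm]
        have h2 : ∑ k ∈ Finset.range n, p ^ (k + 1) = a * ∑ k ∈ Finset.range n, p ^ k + b * ∑ k ∈ Finset.range n, p ^ k := by
          rw [← add_mul, ← h, Finset.mul_sum]; simp only [pow_succ']
        rw [h2]
        refine (add_mono le_rfl (add_mono (mul_mono le_rfl ih) (mul_mono le_rfl h1))).trans ?_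
        apply le_of_eq
        conv_rhs => rw [Gr_eq a]
        simp only [mul_add, add_mul, one_mul, mul_assoc]
        abel
    have := key n x y
    rwa [sum_app] at this
  · have : Gr a * (1 + b * Gr p) ≤ Gr p := by
      apply Gr_mul_le
      apply le_of_eq
      conv_rhs => rw [Gr_eq p]
      nth_rewrite 3 [h]
      rw [add_mul]; abel
    rwa [mul_add, mul_one, ← mul_assoc] at this

/-- Transpose. -/
def tr (p : Ker V) : Ker V := fun x y => p y x
theorem tr_app (p : Ker V) (x y : V) : tr p x y = p y x := rfl
theorem tr_mul (p q : Ker V) : tr (p * q) = tr q * tr p := by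
  ext x y; simp only [mul_app, tr_app]; simp only [mul_comm]
theorem tr_one : tr (1 : Ker V) = 1 := by
  ext x y; by_cases h : x = y <;> simp [tr_app, one_app, h, eq_comm]
theorem tr_pow (p : Ker V) (n : ℕ) : tr (p ^ n) = tr p ^ n := by
  induction n with
  | zero => simp [tr_one]
  | succ n ih => rw [pow_succ, tr_mul, ih, pow_succ']
theorem Gr_tr (p : Ker V) (x y : V) : Gr (tr p) x y = Gr p y x := by
  simp only [Gr_app, ← tr_pow, tr_app]

theorem mul_ne_zero' {p q : Ker V} {x y : V} (h : (p * q) x y ≠ 0) : ∃ z, p x z ≠ 0 ∧ q z y ≠ 0 := by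
  by_contra hc
  push Not at hc
  apply h
  rw [mul_app, ENNReal.tsum_eq_zero]
  intro z
  by_cases hz : p x z = 0
  · simp [hz]
  · simp [hc z hz]

theorem le_mul' (p q : Ker V) (x y z : V) : p x z * q z y ≤ (p * q) x y :=
  ENNReal.le_tsum (f := fun z => p x z * q z y) z

/-- `G(x,y) G(y,z) ≤ C G(x,z)` when `G(y,y) ≤ C`. -/
theorem Gr_mul_Gr_le (p : Ker V) (x y z : V) :
    Gr p x y * Gr p y z ≤ Gr p y y * Gr p x z := by
  classical
  -- split off the steps entering `y`
  set a : Ker V := fun s t => if t = y then 0 else p s t with ha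
  set b : Ker V := fun s t => if t = y then p s t else 0 with hb
  have h : p = a + b := by
    ext s t; rw [add_app]; simp only [ha, hb]; split_ifs <;> simp
  set c : ℝ≥0∞ := Gr a x y + (Gr a * b) x y with hc
  have hbz : ∀ w, w ≠ y → (Gr a * b) x w = 0 := by
    intro w hw
    rw [mul_app, ENNReal.tsum_eq_zero]; intro s; simp [hb, hw]
  have hform : ∀ w, Gr p x w = Gr a x w + (Gr a * b) x y * Gr p y w := by
    intro w
    conv_lhs => rw [resolvent h, add_app, mul_app]
    rw [tsum_eq_single y]
    intro s hs; rw [hbz s hs, zero_mul]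
  by_cases hxy : x = y
  · subst hxy; exact le_rfl
  have hay : ∀ n, (a ^ n) x y = 0 := by
    intro n
    cases n with
    | zero => rw [pow_zero, one_app, if_neg hxy]
    | succ n => rw [pow_succ, mul_app, ENNReal.tsum_eq_zero]; intro s; simp [ha]
  have hGa : Gr a x y = 0 := by rw [Gr_app, ENNReal.tsum_eq_zero]; exact hay
  rw [hform y, hGa, zero_add, hform z, mul_comm _ (Gr p y y), mul_assoc]
  gcongr
  exact le_add_self

end Ker

/-! ### Abstract hyperbolic metrics and the Ancona inequality -/

section Ancona
variable {V : Type}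

/-- Gromov product for an abstract integer valued metric. -/
noncomputable def gr (d : V → V → ℕ) (m x y : V) : ℝ := ((d x m : ℝ) + (d y m : ℝ) - (d x y : ℝ)) / 2

/-- Discrete geodesic hyperbolic metrics. -/
structure Hyp (d : V → V → ℕ) (δ : ℝ) : Prop where
  self : ∀ x, d x x = 0
  symm : ∀ x y, d x y = d y x
  tri : ∀ x y z, d x z ≤ d x y + d y z
  delta : 1 ≤ δ
  hyp : ∀ m x y z, min (gr d m x y) (gr d m y z) - δ ≤ gr d m x z
  geo : ∀ x y i, i ≤ d x y → ∃ m, d x m = i ∧ i + d m y = d x y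

variable {d : V → V → ℕ} {δ : ℝ}

theorem Hyp.triR (H : Hyp d δ) (x y z : V) : (d x z : ℝ) ≤ d x y + d y z := by
  exact_mod_cast H.tri x y z

theorem path_gr (H : Hyp d δ) {a : Ker V} {N : ℕ} (m : V) (R : ℝ)
    (ha : ∀ x y, a x y ≠ 0 → d x y ≤ N ∧ R ≤ d y m) :
    ∀ (k n : ℕ), n ≤ 2 ^ k → ∀ x z, R ≤ d x m → (a ^ n) x z ≠ 0 →
      R ≤ d z m ∧ R - N - k * δ ≤ gr d m x z := by
  have hδ := H.delta
  have base : ∀ n, n ≤ 1 → ∀ x z, R ≤ d x m → (a ^ n) x z ≠ 0 →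
      R ≤ d z m ∧ R - N ≤ gr d m x z := by
    intro n hn x z hx hz
    rcases Nat.le_one_iff_eq_zero_or_eq_one.1 hn with rfl | rfl
    · have hxz : x = z := by
        by_contra hne
        apply hz; rw [pow_zero, Ker.one_app, if_neg hne]
      subst hxz
      refine ⟨hx, ?_⟩
      simp only [gr, H.self]
      have : (0 : ℝ) ≤ N := Nat.cast_nonneg _
      push_cast; linarith
    · rw [pow_one] at hz
      obtain ⟨h1, h2⟩ := ha x z hz
      refine ⟨h2, ?_⟩
      have : (d x z : ℝ) ≤ N := by exact_mod_cast h1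
      have : (0 : ℝ) ≤ N := Nat.cast_nonneg _
      simp only [gr]; linarith
  intro k
  induction k with
  | zero =>
    intro n hn x z hx hz
    have := base n (by simpa using hn) x z hx hz
    refine ⟨this.1, ?_⟩
    push_cast; linarith [this.2]
  | succ k ih =>
    intro n hn x z hx hz
    have hsplit : n / 2 + (n - n / 2) = n := by omega
    rw [← hsplit, pow_add] at hz
    obtain ⟨w, h1, h2⟩ := Ker.mul_ne_zero' hz
    have hp : 2 ^ (k + 1) = 2 * 2 ^ k := by ring
    obtain ⟨hw, h3⟩ := ih (n / 2) (by omega) x w hx h1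
    obtain ⟨hz', h4⟩ := ih (n - n / 2) (by omega) w z hw h2
    refine ⟨hz', ?_⟩
    have := H.hyp m x w z
    have h5 : R - N - k * δ ≤ min (gr d m x w) (gr d m w z) := le_min h3 h4
    push_cast; linarith

theorem tail_bound (C0 ρ : ℝ≥0∞) (f : ℕ → ℝ≥0∞) (M : ℕ) (h0 : ∀ n < M, f n = 0)
    (h1 : ∀ n, f n ≤ C0 * ρ ^ n) : ∑' n, f n ≤ C0 * ρ ^ M * (1 - ρ)⁻¹ := by
  rw [← Summable.sum_add_tsum_nat_add' (k := M) (f := f) ENNReal.summable]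
  rw [Finset.sum_eq_zero (fun n hn => h0 n (Finset.mem_range.1 hn)), zero_add,
    ← ENNReal.tsum_geometric, ← ENNReal.tsum_mul_left]
  refine ENNReal.tsum_le_tsum fun n => (h1 _).trans ?_
  rw [pow_add, mul_comm (ρ ^ n), mul_assoc]

/-- Walk killed outside `Δ`, with uniform constants; `y` is a centre for `Δ`. -/
structure Adm (d : V → V → ℕ) (N : ℕ) (C0 ρ c : ℝ≥0∞) (a : Ker V) (Δ : Set V) (y : V) : Prop where
  range : ∀ x w, a x w ≠ 0 → d x w ≤ N ∧ x ∈ Δ ∧ w ∈ Δ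
  decay : ∀ n x w, (a ^ n) x w ≤ C0 * ρ ^ n
  star : ∀ x ∈ Δ, c ^ (d y x) ≤ Ker.Gr a x y ∧ c ^ (d y x) ≤ Ker.Gr a y x

theorem Adm.tr (H : Hyp d δ) {N : ℕ} {C0 ρ c : ℝ≥0∞} {a : Ker V} {Δ : Set V} {y : V}
    (h : Adm d N C0 ρ c a Δ y) : Adm d N C0 ρ c (Ker.tr a) Δ y where
  range := fun x w hw => by
    obtain ⟨h1, h2, h3⟩ := h.range w x hw
    exact ⟨by rw [H.symm]; exact h1, h3, h2⟩
  decay := fun n x w => by rw [← Ker.tr_pow]; exact h.decay n w x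
  star := fun x hx => by rw [Ker.Gr_tr, Ker.Gr_tr]; exact (h.star x hx).symm

theorem Adm.gr_le {N : ℕ} {C0 ρ c : ℝ≥0∞} {a : Ker V} {Δ : Set V} {y : V}
    (h : Adm d N C0 ρ c a Δ y) (x z : V) : Ker.Gr a x z ≤ C0 * (1 - ρ)⁻¹ := by
  have := tail_bound C0 ρ (fun n => (a ^ n) x z) 0 (by simp) (fun n => h.decay n x z)
  rw [Ker.Gr_app]; simpa using this

theorem anc_step (H : Hyp d δ) {N : ℕ} {C0 ρ c : ℝ≥0∞} {a : Ker V} {Δ : Set V} {y : V}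
    (h : Adm d N C0 ρ c a Δ y) (m x z : V) (R : ℝ) (k : ℕ) (hx : R ≤ d x m)
    (hg : gr d m x z < R - N - k * δ) (T : ℝ≥0∞)
    (hB : ∀ w ∈ Δ, (d w m : ℝ) < R → Ker.Gr a w z ≤ T * (Ker.Gr a w y * Ker.Gr a y z)) :
    Ker.Gr a x z ≤ C0 * ρ ^ (2 ^ k) * (1 - ρ)⁻¹ + T * (Ker.Gr a x y * Ker.Gr a y z) := by
  classical
  set a1 : Ker V := fun s t => if R ≤ d t m then a s t else 0 with ha1
  set b1 : Ker V := fun s t => if R ≤ d t m then 0 else a s t with hb1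
  have hab : a = a1 + b1 := by
    ext s t; rw [Ker.add_app]; simp only [ha1, hb1]; split_ifs <;> simp
  have hle : a1 ≤ a := by
    intro s t; simp only [ha1]; split_ifs <;> simp
  have hres := Ker.resolvent hab
  have e1 : Ker.Gr a x z = Ker.Gr a1 x z + (Ker.Gr a1 * b1 * Ker.Gr a) x z := by
    conv_lhs => rw [hres]
    rfl
  rw [e1]
  refine add_le_add ?_ ?_
  · rw [Ker.Gr_app]
    apply tail_bound
    · intro n hn
      by_contra hne
      have := (path_gr H (a := a1) (N := N) m R ?_ k n hn.le x z hx hne).2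
      · linarith
      · intro s t hst
        simp only [ha1] at hst
        split_ifs at hst with h1
        · exact ⟨(h.range s t hst).1, h1⟩
        · exact absurd rfl hst
    · intro n
      exact (Ker.pow_mono hle n x z).trans (h.decay n x z)
  · have e2 : (Ker.Gr a1 * b1 * Ker.Gr a) x y ≤ Ker.Gr a x y := by
      conv_rhs => rw [hres]
      rw [Ker.add_app]; exact le_add_self
    calc (Ker.Gr a1 * b1 * Ker.Gr a) x z
        ≤ ∑' w, (Ker.Gr a1 * b1) x w * (T * (Ker.Gr a w y * Ker.Gr a y z)) := by
          rw [Ker.mul_app]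
          refine ENNReal.tsum_le_tsum fun w => ?_
          by_cases hw : (Ker.Gr a1 * b1) x w = 0
          · rw [hw]; simp
          obtain ⟨s, _, hs⟩ := Ker.mul_ne_zero' hw
          simp only [hb1] at hs
          split_ifs at hs with h1
          · exact absurd rfl hs
          · gcongr
            exact hB w (h.range s w hs).2.2 (not_le.1 h1)
      _ = T * ((Ker.Gr a1 * b1 * Ker.Gr a) x y * Ker.Gr a y z) := by
          rw [Ker.mul_app, ← ENNReal.tsum_mul_right, ← ENNReal.tsum_mul_left]
          refine tsum_congr fun w => ?_
          ring
      _ ≤ _ := by gcongr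

theorem anc_geom (H : Hyp d δ) {κ : ℝ} (hκ : 0 ≤ κ) {y α β x z m : V} (hαβ : gr d y α β ≤ κ)
    (hm : d y m = d y α / 2) (hm' : d y m + d m α = d y α)
    (hx : 8 * d x α ≤ d y α) (hz : 8 * d z β ≤ d y β)
    (hbig : 3 * κ + 2 * δ + 1 < d y α * (3 / 8 : ℝ)) :
    gr d m x z ≤ κ + 2 * δ ∧ gr d y m β ≤ κ := by
  have hδ := H.delta
  have h1 : (d y m : ℝ) + d m α = d y α := by exact_mod_cast hm'
  have h2 : 2 * (d y m : ℝ) ≤ d y α := by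
    have : 2 * d y m ≤ d y α := by omega
    exact_mod_cast this
  have h3 : (d y α : ℝ) ≤ 2 * (d y m : ℝ) + 1 := by
    have : d y α ≤ 2 * d y m + 1 := by omega
    exact_mod_cast this
  have hx' : 8 * (d x α : ℝ) ≤ d y α := by exact_mod_cast hx
  have hz' : 8 * (d z β : ℝ) ≤ d y β := by exact_mod_cast hz
  have t1 := H.triR α x m
  have t2 := H.triR α m β
  have t3 := H.triR m z β
  have t4 := H.triR m y β
  have b0 : (0 : ℝ) ≤ d y β := Nat.cast_nonneg _
  have b1 : (0 : ℝ) ≤ d x α := Nat.cast_nonneg _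
  have p1 := H.hyp m α x β
  have p2 := H.hyp m x z β
  simp only [gr] at *
  simp only [H.symm α x, H.symm α m, H.symm β m, H.symm α y, H.symm β y, H.symm m y, H.symm x m, H.symm z m] at *
  constructor
  · by_contra hcon
    push Not at hcon
    rcases min_cases ((↑(d m x) + ↑(d m z) - ↑(d x z)) / 2 : ℝ) ((↑(d m z) + ↑(d m β) - ↑(d z β)) / 2) with ⟨e, _⟩ | ⟨e, _⟩ <;>
    rw [e] at p2 <;>
    rcases min_cases ((↑(d m α) + ↑(d m x) - ↑(d x α)) / 2 : ℝ) ((↑(d m x) + ↑(d m β) - ↑(d x β)) / 2) with ⟨e', _⟩ | ⟨e', _⟩ <;>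
    rw [e'] at p1 <;> linarith
  · linarith

theorem anc_const (hδ : 1 ≤ δ) (K : ℝ) {C0 ρ c : ℝ≥0∞} (hC0 : C0 ≠ ⊤) (hρ : ρ < 1) (hc : c ≠ 0) :
    ∃ n0 : ℕ, ∀ n ≥ n0, ∃ k : ℕ, K + k * δ < n / 32 ∧
      C0 * ρ ^ (2 ^ k) * (1 - ρ)⁻¹ ≤ (1 / 2) ^ n * c ^ (2 * n) := by
  have hC1 : C0 * (1 - ρ)⁻¹ ≠ ⊤ := by
    apply ENNReal.mul_ne_top hC0
    rw [ENNReal.inv_ne_top]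
    exact (tsub_pos_of_lt hρ).ne'
  have hlim := ENNReal.tendsto_pow_atTop_nhds_zero_of_lt_one hρ
  have hpos : 0 < (1 / 2) * c ^ 2 := by
    apply ENNReal.mul_pos
    · simp
    · exact pow_ne_zero _ hc
  obtain ⟨M, hM⟩ := (hlim.eventually (gt_mem_nhds hpos)).exists
  have hlim2 : Tendsto (fun n => (C0 * (1 - ρ)⁻¹) * ρ ^ n) atTop (𝓝 ((C0 * (1 - ρ)⁻¹) * 0)) :=
    ENNReal.Tendsto.const_mul hlim (Or.inr hC1)
  rw [mul_zero] at hlim2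
  obtain ⟨M', hM'⟩ := (hlim2.eventually (gt_mem_nhds one_pos)).exists
  -- exponential beats linear
  have hev : ∀ᶠ k : ℕ in atTop, (M * (64 * δ * (k + 1)) + M' : ℝ) ≤ 2 ^ k := by
    have l1 := tendsto_pow_const_mul_const_pow_of_abs_lt_one 1 (r := (1 / 2 : ℝ)) (by norm_num [abs_lt])
    have l2 := tendsto_pow_const_mul_const_pow_of_abs_lt_one 0 (r := (1 / 2 : ℝ)) (by norm_num [abs_lt])
    have l3 := (l1.const_mul (M * (64 * δ))).add (l2.const_mul (M * (64 * δ) + M'))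
    rw [mul_zero, mul_zero, add_zero] at l3
    filter_upwards [l3.eventually (gt_mem_nhds one_pos)] with k hk
    have e : (1 / 2 : ℝ) ^ k = (2 ^ k)⁻¹ := by rw [one_div, inv_pow]
    rw [e] at hk
    have h2 : (0 : ℝ) < 2 ^ k := by positivity
    have : (M * (64 * δ * (k + 1)) + M' : ℝ) * (2 ^ k)⁻¹ ≤ 1 := by
      refine le_trans (le_of_eq ?_) hk.le
      ring
    rwa [← div_eq_mul_inv, div_le_one h2] at this
  obtain ⟨k0, hk0⟩ := eventually_atTop.1 hev
  refine ⟨max (Nat.ceil (64 * δ * k0)) (Nat.ceil (64 * |K|) + 1), fun n hn => ?_⟩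
  have hn1 : 64 * δ * k0 ≤ n := (Nat.ceil_le.1 ((le_max_left _ _).trans hn))
  have hn2 : 64 * |K| < n := by
    have : Nat.ceil (64 * |K|) + 1 ≤ n := (le_max_right _ _).trans hn
    exact Nat.lt_of_ceil_lt this
  have h64 : 0 < 64 * δ := by linarith
  refine ⟨Nat.floor ((n : ℝ) / (64 * δ)), ?_, ?_⟩
  · have : (Nat.floor ((n : ℝ) / (64 * δ)) : ℝ) ≤ n / (64 * δ) := Nat.floor_le (by positivity)
    rw [le_div_iff₀ h64] at this
    have := le_abs_self K
    nlinarith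
  · set k := Nat.floor ((n : ℝ) / (64 * δ)) with hk
    have hkk : k0 ≤ k := by
      apply Nat.le_floor
      rw [le_div_iff₀ h64]; linarith
    have h3 := hk0 k hkk
    have h4 : (n : ℝ) ≤ 64 * δ * (k + 1) := by
      have := (Nat.lt_floor_add_one ((n : ℝ) / (64 * δ))).le
      rw [div_le_iff₀ h64] at this
      linarith
    have h5 : M * n + M' ≤ 2 ^ k := by
      have : (M * n + M' : ℝ) ≤ 2 ^ k := by
        refine le_trans ?_ h3
        gcongr
      exact_mod_cast this
    calc C0 * ρ ^ (2 ^ k) * (1 - ρ)⁻¹ ≤ C0 * ρ ^ (M * n + M') * (1 - ρ)⁻¹ := by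
          exact mul_le_mul' (mul_le_mul' le_rfl (pow_le_pow_right_of_le_one' hρ.le h5)) le_rfl
      _ = (ρ ^ M) ^ n * ((C0 * (1 - ρ)⁻¹) * ρ ^ M') := by
          rw [pow_add, pow_mul]; ring
      _ ≤ ((1 / 2) * c ^ 2) ^ n * 1 := by gcongr
      _ = _ := by rw [mul_one, mul_pow, pow_mul]

theorem ancona (H : Hyp d δ) (N : ℕ) {κ : ℝ} (hκ : 0 ≤ κ) {C0 ρ c : ℝ≥0∞}
    (hC0 : C0 ≠ ⊤) (hρ : ρ < 1) (hc : c ≠ 0) (hc1 : c ≤ 1) :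
    ∃ C : ℝ≥0∞, C ≠ ⊤ ∧ ∀ (a : Ker V) (Δ : Set V) (y : V), Adm d N C0 ρ c a Δ y →
      ∀ x z, x ∈ Δ → z ∈ Δ → gr d y x z ≤ κ →
        Ker.Gr a x z ≤ C * (Ker.Gr a x y * Ker.Gr a y z) := by
  have hδ := H.delta
  obtain ⟨n1, hn1⟩ := anc_const hδ (N + κ + 2 * δ + 1) hC0 hρ hc
  set n0 : ℕ := max n1 (Nat.ceil (16 * (3 * κ + 2 * δ + 1))) with hn0
  set D : ℝ≥0∞ := C0 * (1 - ρ)⁻¹ * (c ^ (2 * n0))⁻¹ with hD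
  set T : ℕ → ℝ≥0∞ := fun n => D + ∑ j ∈ Finset.range (n + 1), (1 / 2 : ℝ≥0∞) ^ j with hT
  have hcpow : ∀ n, c ^ n ≠ 0 := fun n => pow_ne_zero _ hc
  have hcpt : ∀ n, c ^ n ≠ ⊤ := fun n => ENNReal.pow_ne_top (hc1.trans_lt ENNReal.one_lt_top).ne
  have hDtop : D ≠ ⊤ := by
    apply ENNReal.mul_ne_top
    · apply ENNReal.mul_ne_top hC0
      rw [ENNReal.inv_ne_top]
      exact (tsub_pos_of_lt hρ).ne'
    · rw [ENNReal.inv_ne_top]; exact hcpow _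
  have hTle : ∀ n, T n ≤ D + 2 := by
    intro n
    simp only [hT]
    gcongr
    refine (ENNReal.sum_le_tsum _).trans ?_
    rw [ENNReal.tsum_geometric, one_div, ENNReal.one_sub_inv_two, inv_inv]
  have hTmono : ∀ m n, m ≤ n → T m ≤ T n := by
    intro m n hmn
    simp only [hT]
    gcongr
  -- main induction
  have main : ∀ n : ℕ, ∀ (a : Ker V) (Δ : Set V) (y : V), Adm d N C0 ρ c a Δ y →
      ∀ α β x z, gr d y α β ≤ κ → d y α + d y β = n → x ∈ Δ → z ∈ Δ →
        8 * d x α ≤ d y α → 8 * d z β ≤ d y β →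
        Ker.Gr a x z ≤ T n * (Ker.Gr a x y * Ker.Gr a y z) := by
    intro n
    induction n using Nat.strong_induction_on with
    | _ n ih =>
    -- lower bound
    have low : ∀ (a : Ker V) (Δ : Set V) (y : V), Adm d N C0 ρ c a Δ y →
      ∀ α β x z, d y α + d y β = n → x ∈ Δ → z ∈ Δ →
        8 * d x α ≤ d y α → 8 * d z β ≤ d y β → c ^ (2 * n) ≤ Ker.Gr a x y * Ker.Gr a y z := by
      intro a Δ y h α β x z hn hx hz hxα hzβ
      have h1 := H.tri y α x
      have h2 := H.tri y β z
      rw [H.symm α x] at h1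
      rw [H.symm β z] at h2
      calc c ^ (2 * n) ≤ c ^ (d y x + d y z) := pow_le_pow_right_of_le_one' hc1 (by omega)
        _ = c ^ (d y x) * c ^ (d y z) := pow_add _ _ _
        _ ≤ _ := mul_le_mul' (h.star x hx).1 (h.star z hz).2
    by_cases hsmall : n ≤ n0
    · intro a Δ y h α β x z hαβ hn hx hz hxα hzβ
      have hl := low a Δ y h α β x z hn hx hz hxα hzβ
      calc Ker.Gr a x z ≤ C0 * (1 - ρ)⁻¹ := h.gr_le x z
        _ = D * c ^ (2 * n0) := by
            rw [hD, mul_assoc, ENNReal.inv_mul_cancel (hcpow _) (hcpt _), mul_one]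
        _ ≤ D * c ^ (2 * n) := by
            exact mul_le_mul' le_rfl (pow_le_pow_right_of_le_one' hc1 (by omega))
        _ ≤ T n * (Ker.Gr a x y * Ker.Gr a y z) := by
            gcongr
            simp only [hT]; exact le_self_add
    push Not at hsmall
    -- half of the claim
    have half : ∀ (a : Ker V) (Δ : Set V) (y : V), Adm d N C0 ρ c a Δ y →
      ∀ α β x z, gr d y α β ≤ κ → d y α + d y β = n → x ∈ Δ → z ∈ Δ →
        8 * d x α ≤ d y α → 8 * d z β ≤ d y β → d y β ≤ d y α →
        Ker.Gr a x z ≤ T n * (Ker.Gr a x y * Ker.Gr a y z) := by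
      intro a Δ y h α β x z hαβ hn hx hz hxα hzβ hle
      have hl := low a Δ y h α β x z hn hx hz hxα hzβ
      obtain ⟨m, hm, hm'⟩ := H.geo y α (d y α / 2) (Nat.div_le_self _ _)
      rw [← hm] at hm'
      have hnn0 : (16 * (3 * κ + 2 * δ + 1) : ℝ) < n := by
        have : Nat.ceil (16 * (3 * κ + 2 * δ + 1)) < n := (le_max_right _ _).trans_lt hsmall
        exact Nat.lt_of_ceil_lt this
      have hA : (n : ℝ) ≤ 2 * d y α := by
        have : n ≤ 2 * d y α := by omega
        exact_mod_cast this
      obtain ⟨g1, g2⟩ := anc_geom H hκ hαβ hm hm' hxα hzβ (by nlinarith)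
      obtain ⟨k, hk1, hk2⟩ := hn1 n ((le_max_left _ _).trans hsmall.le)
      have hmR : (d y α : ℝ) ≤ 2 * d y m + 1 := by
        have : d y α ≤ 2 * d y m + 1 := by omega
        exact_mod_cast this
      have hmR2 : 2 * (d y m : ℝ) ≤ d y α := by
        have : 2 * d y m ≤ d y α := by omega
        exact_mod_cast this
      have hAm : (d y m : ℝ) + d m α = d y α := by exact_mod_cast hm'
      have hxαR : 8 * (d x α : ℝ) ≤ d y α := by exact_mod_cast hxα
      have hd0 : (0 : ℝ) ≤ d y α := Nat.cast_nonneg _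
      have hlt : d y m + d y β < n := by
        have : 0 < d y α := by
          have : (0 : ℝ) < d y α := by nlinarith
          exact_mod_cast this
        omega
      have step := anc_step H h m x z ((d y m : ℝ) / 8) k ?_ ?_ (T (n - 1)) ?_
      · have hTn : T n = T (n - 1) + (1 / 2) ^ n := by
          obtain ⟨n', rfl⟩ : ∃ n', n = n' + 1 := ⟨n - 1, by omega⟩
          simp only [hT, Nat.add_sub_cancel]
          rw [Finset.sum_range_succ _ (n' + 1), add_assoc]
        rw [hTn, add_mul, add_comm]
        refine step.trans (add_le_add (hk2.trans ?_) le_rfl)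
        gcongr
      · have := H.triR m x α
        rw [H.symm m x] at this
        linarith
      · linarith
      · intro w hw hwm
        have := ih (d y m + d y β) hlt a Δ y h m β w z g2 rfl hw hz ?_ hzβ
        · refine this.trans ?_
          gcongr
          exact hTmono _ _ (by omega)
        · have : (8 * d w m : ℝ) ≤ d y m := by linarith
          exact_mod_cast this
    intro a Δ y h α β x z hαβ hn hx hz hxα hzβ
    rcases le_total (d y β) (d y α) with hle | hle
    · exact half a Δ y h α β x z hαβ hn hx hz hxα hzβ hle
    · have := half (Ker.tr a) Δ y (h.tr H) β α z x (by
        simp only [gr] at *; rw [H.symm β α]; linarith) (by omega) hz hx hzβ hxα hle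
      rw [Ker.Gr_tr, Ker.Gr_tr, Ker.Gr_tr] at this
      rwa [mul_comm (Ker.Gr a x y)]
  refine ⟨D + 2, by simp [hDtop], fun a Δ y h x z hx hz hxz => ?_⟩
  refine (main _ a Δ y h x z x z hxz rfl hx hz (by simp [H.self]) (by simp [H.self])).trans ?_
  gcongr
  exact hTle _

end Ancona

/-! ### Contraction of ratios of harmonic functions -/

section Contraction
variable {V : Type} {d : V → V → ℕ} {δ : ℝ}

open Classical in
/-- Kernel killed outside `Ω`. -/
noncomputable def kin (R : Ker V) (Ω : Set V) : Ker V := fun x w => if x ∈ Ω ∧ w ∈ Ω then R x w else 0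

open Classical in
/-- The complementary part of the kernel. -/
noncomputable def kout (R : Ker V) (Ω : Set V) : Ker V := fun x w => if x ∈ Ω ∧ w ∈ Ω then 0 else R x w

theorem kin_add (R : Ker V) (Ω : Set V) : R = kin R Ω + kout R Ω := by
  ext x w
  rw [Ker.add_app]; simp only [kin, kout]; split_ifs <;> simp

theorem kin_le (R : Ker V) (Ω : Set V) : kin R Ω ≤ R := by
  intro x w; simp only [kin]; split_ifs <;> simp

theorem Gr_kin_out (R : Ker V) (Ω : Set V) {x w : V} (hx : x ∈ Ω) (hw : w ∉ Ω) :
    Ker.Gr (kin R Ω) x w = 0 := by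
  rw [Ker.Gr_app, ENNReal.tsum_eq_zero]
  intro n
  cases n with
  | zero => rw [pow_zero, Ker.one_app, if_neg]; rintro rfl; exact hw hx
  | succ n =>
    rw [pow_succ, Ker.mul_app, ENNReal.tsum_eq_zero]; intro s
    simp [kin, hw]

/-- exit kernel -/
noncomputable def Hk (R : Ker V) (Ω : Set V) : Ker V := Ker.Gr (kin R Ω) * kout R Ω

theorem Hk_ne {R : Ker V} {Ω : Set V} {x w : V} (hx : x ∈ Ω) (h : Hk R Ω x w ≠ 0) :
    w ∉ Ω ∧ ∃ w' ∈ Ω, R w' w ≠ 0 := by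
  obtain ⟨w', h1, h2⟩ := Ker.mul_ne_zero' h
  have hw' : w' ∈ Ω := by
    by_contra hc; exact h1 (Gr_kin_out R Ω hx hc)
  have hw : w ∉ Ω := by
    intro hw; apply h2; simp [kout, hw, hw']
  refine ⟨hw, w', hw', ?_⟩
  intro h0; apply h2; simp [kout, h0]

theorem Gr_exit {R : Ker V} {Ω : Set V} {x z : V} (hx : x ∈ Ω) (hz : z ∉ Ω) :
    Ker.Gr R x z = ∑' w, Hk R Ω x w * Ker.Gr R w z := by
  conv_lhs => rw [Ker.resolvent (kin_add R Ω), Ker.add_app, Gr_kin_out R Ω hx hz, zero_add]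
  rfl

theorem Hk_lower {R : Ker V} {Ω : Set V} {y : V} {K : ℝ≥0∞}
    (hK : Ker.Gr (kin R Ω) y y ≤ K) (x w : V) :
    Ker.Gr (kin R Ω) x y * Hk R Ω y w ≤ K * Hk R Ω x w := by
  simp only [Hk, Ker.mul_app, ← ENNReal.tsum_mul_left]
  refine ENNReal.tsum_le_tsum fun w' => ?_
  rw [← mul_assoc, ← mul_assoc]
  exact mul_le_mul' ((Ker.Gr_mul_Gr_le _ _ _ _).trans (mul_le_mul' hK le_rfl)) le_rfl

theorem Hk_upper {R : Ker V} {Ω : Set V} {y : V} {C : ℝ≥0∞} {x : V} (hx : x ∈ Ω)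
    (hC : ∀ w' ∈ Ω, (∃ w, w ∉ Ω ∧ R w' w ≠ 0) →
      Ker.Gr (kin R Ω) x w' ≤ C * (Ker.Gr (kin R Ω) x y * Ker.Gr (kin R Ω) y w')) (w : V) :
    Hk R Ω x w ≤ C * (Ker.Gr (kin R Ω) x y * Hk R Ω y w) := by
  simp only [Hk, Ker.mul_app, ← ENNReal.tsum_mul_left]
  refine ENNReal.tsum_le_tsum fun w' => ?_
  by_cases hw' : w' ∈ Ω
  · by_cases h0 : kout R Ω w' w = 0
    · simp [h0]
    · have : w ∉ Ω ∧ R w' w ≠ 0 := by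
        constructor
        · intro hw; apply h0; simp [kout, hw, hw']
        · intro h; apply h0; simp [kout, h]
      calc _ ≤ C * (Ker.Gr (kin R Ω) x y * Ker.Gr (kin R Ω) y w') * kout R Ω w' w := by
            gcongr; exact hC w' hw' ⟨w, this⟩
        _ = _ := by ring
  · rw [Gr_kin_out R Ω hx hw', zero_mul]; exact zero_le

/-- comparison of harmonic functions -/
theorem compare_init {H : Ker V} {x y : V} {φ C K : ℝ≥0∞} (u v : V → ℝ≥0∞)
    (hup : ∀ w, H x w ≤ C * (φ * H y w)) (hlo : ∀ w, φ * H y w ≤ K * H x w) :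
    (∑' w, H x w * u w) * (∑' w, H y w * v w) ≤
      C * K * ((∑' w, H x w * v w) * (∑' w, H y w * u w)) := by
  have h1 : (∑' w, H x w * u w) ≤ C * (φ * ∑' w, H y w * u w) := by
    simp only [← ENNReal.tsum_mul_left]
    refine ENNReal.tsum_le_tsum fun w => ?_
    rw [← mul_assoc, ← mul_assoc]; rw [mul_assoc C]; gcongr; exact hup w
  have h2 : φ * (∑' w, H y w * v w) ≤ K * ∑' w, H x w * v w := by
    simp only [← ENNReal.tsum_mul_left]
    refine ENNReal.tsum_le_tsum fun w => ?_
    rw [← mul_assoc, ← mul_assoc]; exact mul_le_mul' (hlo w) le_rfl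
  calc _ ≤ C * (φ * ∑' w, H y w * u w) * (∑' w, H y w * v w) := by gcongr
    _ = C * (∑' w, H y w * u w) * (φ * (∑' w, H y w * v w)) := by ring
    _ ≤ C * (∑' w, H y w * u w) * (K * ∑' w, H x w * v w) := by gcongr
    _ = _ := by ring

theorem contract {H : Ker V} {Ωm : Set V} {y : V} {φ : V → ℝ≥0∞} {C K : ℝ≥0∞}
    (hC : C ≠ ⊤) (hK : K ≠ ⊤) (hCK : 1 ≤ C * K)
    {u v : V → ℝ≥0∞} (hu : ∀ x, u x ≠ ⊤) (hv : ∀ x, v x ≠ ⊤)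
    (hup : ∀ x ∈ Ωm, ∀ w, H x w ≤ C * (φ x * H y w))
    (hlo : ∀ x ∈ Ωm, ∀ w, φ x * H y w ≤ K * H x w)
    (hux : ∀ x ∈ insert y Ωm, u x = ∑' w, H x w * u w)
    (hvx : ∀ x ∈ insert y Ωm, v x = ∑' w, H x w * v w)
    {A L : ℝ≥0∞} (hA : A ≠ ⊤) (hL : L ≠ ⊤)
    (h : ∀ x ∈ insert y Ωm, ∀ w, H x w ≠ 0 → A * v w ≤ u w ∧ u w ≤ (A + L) * v w) :
    ∃ A', A ≤ A' ∧ A' ≠ ⊤ ∧ ∀ x ∈ Ωm, A' * v x ≤ u x ∧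
      u x ≤ (A' + (1 - (2 * (C * K))⁻¹) * L) * v x := by
  set θ := (2 * (C * K))⁻¹ with hθ
  have hCKt : C * K ≠ ⊤ := ENNReal.mul_ne_top hC hK
  have hCK0 : C * K ≠ 0 := (zero_lt_one.trans_le hCK).ne'
  have h2CK : θ * (2 * (C * K)) = 1 :=
    ENNReal.inv_mul_cancel (mul_ne_zero two_ne_zero hCK0) (ENNReal.mul_ne_top ENNReal.ofNat_ne_top hCKt)
  have hθ1 : θ ≤ 1 := by
    rw [hθ, ENNReal.inv_le_one]
    calc (1 : ℝ≥0∞) ≤ C * K := hCK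
      _ ≤ 2 * (C * K) := by rw [two_mul]; exact le_self_add
  have hq : θ + (1 - θ) = 1 := add_tsub_cancel_of_le hθ1
  set q := 1 - θ with hqd
  have hθt : θ ≠ ⊤ := (hθ1.trans_lt ENNReal.one_lt_top).ne
  set s : V → ℝ≥0∞ := fun w => u w - A * v w with hs
  set t : V → ℝ≥0∞ := fun w => (A + L) * v w - u w with ht
  set Sf : V → ℝ≥0∞ := fun x => ∑' w, H x w * s w with hSf
  set Tf : V → ℝ≥0∞ := fun x => ∑' w, H x w * t w with hTf
  have e1 : ∀ x ∈ insert y Ωm, u x = A * v x + Sf x := by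
    intro x hx
    rw [hux x hx, hvx x hx, hSf, ← ENNReal.tsum_mul_left, ← ENNReal.tsum_add]
    refine tsum_congr fun w => ?_
    by_cases hw : H x w = 0
    · simp [hw]
    · have := (h x hx w hw).1
      rw [mul_left_comm, ← mul_add]; congr 1; exact (add_tsub_cancel_of_le this).symm
  have e2 : ∀ x ∈ insert y Ωm, (A + L) * v x = u x + Tf x := by
    intro x hx
    rw [hux x hx, hvx x hx, hTf, ← ENNReal.tsum_mul_left]
    simp only
    rw [← ENNReal.tsum_add]
    refine tsum_congr fun w => ?_
    by_cases hw : H x w = 0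
    · simp [hw]
    · have := (h x hx w hw).2
      rw [mul_left_comm, ← mul_add]; congr 1; exact (add_tsub_cancel_of_le this).symm
  have ey : Sf y + Tf y = L * v y := by
    have h1 := e1 y (Set.mem_insert _ _)
    have h2 := e2 y (Set.mem_insert _ _)
    rw [h1, add_mul, add_assoc] at h2
    exact ((ENNReal.add_right_inj (ENNReal.mul_ne_top hA (hv y))).1 h2).symm
  have low : ∀ (f : V → ℝ≥0∞), ∀ x ∈ Ωm, φ x * (∑' w, H y w * f w) ≤ K * ∑' w, H x w * f w := by
    intro f x hx
    simp only [← ENNReal.tsum_mul_left]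
    refine ENNReal.tsum_le_tsum fun w => ?_
    rw [← mul_assoc, ← mul_assoc]; exact mul_le_mul' (hlo x hx w) le_rfl
  have upv : ∀ x ∈ Ωm, v x ≤ C * (φ x * v y) := by
    intro x hx
    rw [hvx x (Set.mem_insert_of_mem _ hx), hvx y (Set.mem_insert _ _)]
    simp only [← ENNReal.tsum_mul_left]
    refine ENNReal.tsum_le_tsum fun w => ?_
    rw [← mul_assoc, ← mul_assoc]; rw [mul_assoc C]; gcongr; exact hup x hx w
  -- common estimate
  have common : ∀ (F : V → ℝ≥0∞), (∀ x ∈ Ωm, φ x * F y ≤ K * F x) → L * v y ≤ 2 * F y →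
      ∀ x ∈ Ωm, θ * L * v x ≤ F x := by
    intro F hF hy x hx
    calc θ * L * v x ≤ θ * L * (C * (φ x * v y)) := by gcongr; exact upv x hx
      _ = θ * C * φ x * (L * v y) := by ring
      _ ≤ θ * C * φ x * (2 * F y) := by gcongr
      _ = θ * C * 2 * (φ x * F y) := by ring
      _ ≤ θ * C * 2 * (K * F x) := mul_le_mul' le_rfl (hF x hx)
      _ = (θ * (2 * (C * K))) * F x := by ring
      _ = F x := by rw [h2CK, one_mul]
  rcases le_total (Tf y) (Sf y) with hc | hc
  · have hS := common Sf (low s) (by rw [← ey, two_mul]; gcongr)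
    refine ⟨A + θ * L, le_self_add, ENNReal.add_ne_top.2 ⟨hA, ENNReal.mul_ne_top hθt hL⟩, fun x hx => ⟨?_, ?_⟩⟩
    · rw [e1 x (Set.mem_insert_of_mem _ hx), add_mul]
      gcongr; exact hS x hx
    · rw [add_assoc, ← add_mul, hq, one_mul, e2 x (Set.mem_insert_of_mem _ hx)]
      exact le_self_add
  · have hT := common Tf (low t) (by rw [← ey, two_mul]; gcongr)
    refine ⟨A, le_rfl, hA, fun x hx => ⟨?_, ?_⟩⟩
    · rw [e1 x (Set.mem_insert_of_mem _ hx)]; exact le_self_add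
    · have h2 := e2 x (Set.mem_insert_of_mem _ hx)
      have hTt : Tf x ≠ ⊤ := by
        intro htop
        rw [htop, add_top] at h2
        exact ENNReal.mul_ne_top (ENNReal.add_ne_top.2 ⟨hA, hL⟩) (hv x) h2
      have : u x + Tf x ≤ (A + q * L) * v x + Tf x := by
        rw [← h2]
        calc (A + L) * v x = (A + (θ + q) * L) * v x := by rw [hq, one_mul]
          _ = (A + q * L) * v x + θ * L * v x := by ring
          _ ≤ _ := by gcongr; exact hT x hx
      exact (ENNReal.add_le_add_iff_right hTt).1 this

end Contraction

/-! ### Hölder estimate for ratios of Green kernels, abstract form -/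

section HolderAbs
variable {V : Type} {d : V → V → ℕ} {δ : ℝ}

/-- Uniformly elliptic finite range walk with exponential decay. -/
structure Walk (d : V → V → ℕ) (N : ℕ) (ρ c : ℝ≥0∞) (R : Ker V) : Prop where
  range : ∀ x w, R x w ≠ 0 → d x w ≤ N
  decay : ∀ n x w, (R ^ n) x w ≤ ρ ^ n
  low : ∀ x w, d x w = 1 → c ≤ R x w

theorem star_lower (H : Hyp d δ) {c : ℝ≥0∞} {R : Ker V} (hlow : ∀ x w, d x w = 1 → c ≤ R x w)
    (h0 : ∀ x y, d x y = 0 → x = y)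
    {Ω : Set V} {y : V} (hstar : ∀ x ∈ Ω, ∀ p, d x p + d p y = d x y → p ∈ Ω) :
    ∀ (n : ℕ) (x : V), x ∈ Ω → d x y = n →
      c ^ n ≤ Ker.Gr (kin R Ω) x y ∧ c ^ n ≤ Ker.Gr (kin R Ω) y x := by
  intro n
  induction n with
  | zero =>
    intro x hx hn
    have := h0 x y hn
    subst this
    have h1 : (1 : ℝ≥0∞) ≤ Ker.Gr (kin R Ω) x x := by
      have := Ker.pow_le_Gr (kin R Ω) 0 x x
      rwa [pow_zero, Ker.one_app, if_pos rfl] at this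
    simpa using h1
  | succ n ih =>
    intro x hx hn
    obtain ⟨p, hp1, hp2⟩ := H.geo x y 1 (by omega)
    have hp : p ∈ Ω := hstar x hx p (by omega)
    obtain ⟨i1, i2⟩ := ih p hp (by omega)
    constructor
    · rw [Ker.Gr_eq, Ker.add_app, pow_succ']
      refine le_trans ?_ le_add_self
      refine le_trans ?_ (Ker.le_mul' _ _ x y p)
      refine mul_le_mul' ?_ i1
      simp only [kin, hx, hp, and_self, if_true]
      exact hlow x p hp1
    · rw [Ker.Gr_eq', Ker.add_app, pow_succ]
      refine le_trans ?_ le_add_self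
      refine le_trans ?_ (Ker.le_mul' _ _ y x p)
      refine mul_le_mul' i2 ?_
      simp only [kin, hx, hp, and_self, if_true]
      exact hlow p x (by rw [H.symm]; exact hp1)

theorem Gr_pos (H : Hyp d δ) {c : ℝ≥0∞} {R : Ker V} (hlow : ∀ x w, d x w = 1 → c ≤ R x w)
    (h0 : ∀ x y, d x y = 0 → x = y) (x y : V) : c ^ (d x y) ≤ Ker.Gr R x y :=
  ((star_lower H hlow h0 (Ω := Set.univ) (y := y) (fun _ _ _ _ => trivial) _ x trivial rfl).1).trans
    (Ker.Gr_mono (kin_le R _) x y)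

theorem Walk.Gr_le {N : ℕ} {ρ c : ℝ≥0∞} {R : Ker V} (W : Walk d N ρ c R) (x y : V) :
    Ker.Gr R x y ≤ (1 - ρ)⁻¹ := by
  rw [Ker.Gr_app, ← ENNReal.tsum_geometric]
  exact ENNReal.tsum_le_tsum fun n => W.decay n x y

theorem Walk.adm (H : Hyp d δ) {N : ℕ} {ρ c : ℝ≥0∞} {R : Ker V} (W : Walk d N ρ c R)
    (h0 : ∀ x y, d x y = 0 → x = y) {Ω : Set V} {y : V}
    (hstar : ∀ x ∈ Ω, ∀ p, d x p + d p y = d x y → p ∈ Ω) : Adm d N 1 ρ c (kin R Ω) Ω y where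
  range := by
    intro x w hw
    simp only [kin] at hw
    split_ifs at hw with hc
    · exact ⟨W.range x w hw, hc⟩
    · exact absurd rfl hw
  decay := by
    intro n x w
    rw [one_mul]
    exact (Ker.pow_mono (kin_le R Ω) n x w).trans (W.decay n x w)
  star := by
    intro x hx
    exact star_lower H W.low h0 hstar _ x hx (H.symm x y)

theorem exists_chain (H : Hyp d δ) (D : ℕ) (o z : V) : ∃ Y : ℕ → V, Y 0 = o ∧
    (∀ k, k * D ≤ d o z → d o (Y k) = k * D ∧ k * D + d (Y k) z = d o z) ∧
    (∀ k, (k + 1) * D ≤ d o z → d (Y k) (Y (k + 1)) = D ∧ D + d (Y (k + 1)) z = d (Y k) z) := by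
  classical
  have : ∀ y, ∃ m, D ≤ d y z → d y m = D ∧ D + d m z = d y z := by
    intro y
    by_cases h : D ≤ d y z
    · obtain ⟨m, hm⟩ := H.geo y z D h
      exact ⟨m, fun _ => hm⟩
    · exact ⟨y, fun h' => absurd h' h⟩
  choose f hf using this
  set Y : ℕ → V := fun k => f^[k] o with hY
  have hs : ∀ k, Y (k + 1) = f (Y k) := fun k => Function.iterate_succ_apply' f k o
  have h1 : ∀ k, k * D ≤ d o z → d o (Y k) ≤ k * D ∧ k * D + d (Y k) z = d o z := by
    intro k
    induction k with
    | zero => intro _; simp [hY, H.self]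
    | succ k ih =>
      intro hk
      have hk' : (k + 1) * D = k * D + D := by ring
      obtain ⟨i1, i2⟩ := ih (by omega)
      obtain ⟨j1, j2⟩ := hf (Y k) (by omega)
      rw [hs]
      have := H.tri o (Y k) (f (Y k))
      omega
  refine ⟨Y, rfl, fun k hk => ?_, fun k hk => ?_⟩
  · obtain ⟨i1, i2⟩ := h1 k hk
    have := H.tri o (Y k) z
    omega
  · have hk' : (k + 1) * D = k * D + D := by ring
    obtain ⟨i1, i2⟩ := h1 k (by omega)
    rw [hs]
    exact hf (Y k) (by omega)

theorem holder_abs (H : Hyp d δ) {N : ℕ} {ρ c : ℝ≥0∞} (hρ : ρ < 1) (hc : c ≠ 0) (hc1 : c ≤ 1)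
    (h0 : ∀ x y, d x y = 0 → x = y) :
    ∃ (q M : ℝ≥0∞) (D L : ℕ), q < 1 ∧ M ≠ ⊤ ∧ ∀ R : Ker V, Walk d N ρ c R →
      ∀ (o z z' : V) (r n : ℕ), ((2 * n + r) * D + L : ℕ) ≤ gr d o z z' →
      ∀ x x', d o x ≤ r → d o x' ≤ r →
      Ker.Gr R x z * Ker.Gr R x' z' ≤ (1 + q ^ n * M) * (Ker.Gr R x z' * Ker.Gr R x' z) := by
  have hδ := H.delta
  obtain ⟨C1, hC1, hanc⟩ := ancona H N (κ := 2 * δ + N) (by positivity) (C0 := 1)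
    ENNReal.one_ne_top hρ hc hc1
  set C : ℝ≥0∞ := max C1 1 with hCdef
  have hC : C ≠ ⊤ := (max_lt hC1.lt_top ENNReal.one_lt_top).ne
  set K : ℝ≥0∞ := (1 - ρ)⁻¹ with hKdef
  have hρ1 : 1 - ρ ≠ 0 := (tsub_pos_of_lt hρ).ne'
  have hK : K ≠ ⊤ := ENNReal.inv_ne_top.2 hρ1
  have hK1 : 1 ≤ K := by
    rw [hKdef, ENNReal.one_le_inv]; exact tsub_le_self
  have hCK : 1 ≤ C * K := by
    calc (1 : ℝ≥0∞) = 1 * 1 := by simp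
      _ ≤ C * K := mul_le_mul' (le_max_right _ _) hK1
  have hCKt : C * K ≠ ⊤ := ENNReal.mul_ne_top hC hK
  have hCK0 : C * K ≠ 0 := (zero_lt_one.trans_le hCK).ne'
  set D : ℕ := ⌈N + 4 * δ⌉₊ + 1 with hD
  have hDr : (N : ℝ) + 4 * δ < D := by
    rw [hD]; push_cast
    exact (Nat.le_ceil _).trans_lt (by linarith)
  set L : ℕ := 3 * D with hL
  refine ⟨1 - (2 * (C * K))⁻¹, (C * K) ^ 2, D, L, ?_, ENNReal.pow_ne_top hCKt, ?_⟩
  · refine ENNReal.sub_lt_self ENNReal.one_ne_top one_ne_zero ?_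
    exact ENNReal.inv_ne_zero.2 (ENNReal.mul_ne_top ENNReal.ofNat_ne_top hCKt)
  set q : ℝ≥0∞ := 1 - (2 * (C * K))⁻¹ with hq
  intro R W o z z' r n hT x x' hx hx'
  obtain ⟨Y, -, hY1, hY2⟩ := exists_chain H D o z
  set n0 := r + 2 + 2 * n with hn0
  have hlz : (gr d o z z') ≤ d o z := by
    have := H.triR z' z o
    rw [H.symm z' z] at this
    have h2 : (d z o : ℝ) = d o z := by rw [H.symm]
    simp only [gr]; linarith
  have hTn : (n0 * D : ℝ) + D ≤ gr d o z z' := by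
    refine le_trans ?_ hT
    rw [hn0, hL]; push_cast; linarith
  have hkD : ∀ k, k ≤ n0 → (k * D : ℝ) ≤ n0 * D := by
    intro k hk
    have : (k : ℝ) ≤ n0 := by exact_mod_cast hk
    gcongr
  have hkl : ∀ k, k ≤ n0 → k * D ≤ d o z := by
    intro k hk
    have h1 := hkD k hk
    have : (k * D : ℝ) ≤ d o z := by
      have : (0 : ℝ) ≤ D := Nat.cast_nonneg _
      linarith
    exact_mod_cast this
  -- real versions
  have Y1 : ∀ k, k ≤ n0 → (d o (Y k) : ℝ) = k * D ∧ (k * D : ℝ) + d (Y k) z = d o z := by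
    intro k hk
    obtain ⟨i1, i2⟩ := hY1 k (hkl k hk)
    exact ⟨by exact_mod_cast i1, by exact_mod_cast i2⟩
  have Y2 : ∀ k, k + 1 ≤ n0 → (d (Y k) (Y (k + 1)) : ℝ) = D ∧ (D : ℝ) + d (Y (k + 1)) z = d (Y k) z := by
    intro k hk
    obtain ⟨i1, i2⟩ := hY2 k (hkl _ hk)
    exact ⟨by exact_mod_cast i1, by exact_mod_cast i2⟩
  set Ω : ℕ → Set V := fun k => {h | gr d (Y k) h z ≤ 2 * δ} with hΩ
  have mem : ∀ k h, h ∈ Ω k ↔ gr d (Y k) h z ≤ 2 * δ := fun _ _ => Iff.rfl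
  -- (i)
  have zout : ∀ k, k ≤ n0 → z ∉ Ω k := by
    intro k hk hz
    rw [mem] at hz
    simp only [gr, H.self] at hz
    have h1 := hkD k hk
    obtain ⟨i1, i2⟩ := Y1 k hk
    rw [H.symm z (Y k)] at hz
    push_cast at hz
    have : (0 : ℝ) ≤ N := Nat.cast_nonneg _
    linarith
  have zout' : ∀ k, k ≤ n0 → z' ∉ Ω k := by
    intro k hk hz
    rw [mem] at hz
    have h1 := hkD k hk
    obtain ⟨i1, i2⟩ := Y1 k hk
    have t1 := H.triR z' (Y k) o
    have hs1 : (d (Y k) o : ℝ) = d o (Y k) := by rw [H.symm]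
    have hs2 : (d z (Y k) : ℝ) = d (Y k) z := by rw [H.symm]
    have hs3 : (d z o : ℝ) = d o z := by rw [H.symm]
    have hs4 : (d z' z : ℝ) = d z z' := by rw [H.symm]
    have : (0 : ℝ) ≤ N := Nat.cast_nonneg _
    simp only [gr] at hz hTn
    linarith
  -- (ii)
  have push : ∀ k, k + 1 ≤ n0 → ∀ h ∈ Ω k, ∀ h', d h h' ≤ N → gr d (Y (k + 1)) h' z ≤ δ := by
    intro k hk h hh h' hd
    rw [mem] at hh
    have hd' : (d h h' : ℝ) ≤ N := by exact_mod_cast hd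
    obtain ⟨i1, i2⟩ := Y2 k hk
    have t1 := H.triR h' h (Y k)
    have t2 := H.triR h h' z
    have hs0 : (d h' h : ℝ) = d h h' := by rw [H.symm]
    have hs1 : (d (Y (k+1)) (Y k) : ℝ) = d (Y k) (Y (k+1)) := by rw [H.symm]
    have hs2 : (d z (Y k) : ℝ) = d (Y k) z := by rw [H.symm]
    have hs3 : (d z (Y (k+1)) : ℝ) = d (Y (k+1)) z := by rw [H.symm]
    have a1 := H.hyp (Y k) h' (Y (k+1)) z
    have a2 := H.hyp (Y (k+1)) (Y k) h' z
    have hs4 : (d (Y k) h' : ℝ) = d h' (Y k) := by rw [H.symm]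
    have hs5 : (d (Y (k+1)) h' : ℝ) = d h' (Y (k+1)) := by rw [H.symm]
    by_contra hcon
    push Not at hcon
    have b1 : gr d (Y k) h' (Y (k+1)) ≤ 3 * δ + N := by
      by_contra hb
      push Not at hb
      have : 3 * δ + N < min (gr d (Y k) h' (Y (k+1))) (gr d (Y k) (Y (k+1)) z) := by
        refine lt_min hb ?_
        simp only [gr]; linarith
      simp only [gr] at *
      linarith
    have : δ < min (gr d (Y (k+1)) (Y k) h') (gr d (Y (k+1)) h' z) := by
      refine lt_min ?_ hcon
      simp only [gr] at *; linarith
    have b3 : gr d (Y (k+1)) (Y k) z = 0 := by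
      simp only [gr]; linarith
    linarith
  have incl : ∀ k, k + 1 ≤ n0 → Ω k ⊆ Ω (k + 1) := by
    intro k hk h hh
    have := push k hk h hh h (by rw [H.self]; exact Nat.zero_le _)
    rw [mem]; linarith
  -- (iv)
  have adm : ∀ k, Adm d N 1 ρ c (kin R (Ω k)) (Ω k) (Y k) := by
    intro k
    refine W.adm H h0 ?_
    intro h hh p hp
    rw [mem] at hh ⊢
    have hp' : (d h p : ℝ) + d p (Y k) = d h (Y k) := by exact_mod_cast hp
    have := H.triR h p z
    simp only [gr] at *; linarith
  have yin : ∀ k, Y k ∈ Ω k := by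
    intro k
    rw [mem]; simp only [gr, H.self]
    rw [H.symm z (Y k)]; push_cast; linarith
  -- comparison constants
  have hup : ∀ k, k + 1 ≤ n0 → ∀ x ∈ Ω k, ∀ w, Hk R (Ω (k+1)) x w ≤
      C * (Ker.Gr (kin R (Ω (k+1))) x (Y (k+1)) * Hk R (Ω (k+1)) (Y (k+1)) w) := by
    intro k hk x hx
    refine Hk_upper (incl k hk hx) ?_
    rintro w' hw' ⟨w, hw, hRw⟩
    have := hanc _ _ _ (adm (k+1)) x w' (incl k hk hx) hw' ?_
    · exact this.trans (mul_le_mul' (le_max_left _ _) le_rfl)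
    · rw [mem] at hw
      push Not at hw
      have e1 := push k hk x hx x (by rw [H.self]; exact Nat.zero_le _)
      have e2 := H.hyp (Y (k+1)) x w z
      have e3 : gr d (Y (k+1)) x w ≤ 2 * δ := by
        by_contra hb
        push Not at hb
        have : 2 * δ < min (gr d (Y (k+1)) x w) (gr d (Y (k+1)) w z) := lt_min hb hw
        linarith
      have hd : (d w' w : ℝ) ≤ N := by exact_mod_cast W.range _ _ hRw
      have t1 := H.triR w' w (Y (k+1))
      have t2 := H.triR x w' w
      simp only [gr] at *; linarith
  have hlo : ∀ k, ∀ x w, Ker.Gr (kin R (Ω k)) x (Y k) * Hk R (Ω k) (Y k) w ≤ K * Hk R (Ω k) x w := by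
    intro k x w
    refine Hk_lower ?_ x w
    have := (adm k).gr_le (Y k) (Y k)
    rwa [one_mul] at this
  set u : V → ℝ≥0∞ := fun x => Ker.Gr R x z with hu
  set v : V → ℝ≥0∞ := fun x => Ker.Gr R x z' with hv
  have hut : ∀ x, u x ≠ ⊤ := fun x => ((W.Gr_le x z).trans_lt hK.lt_top).ne
  have hvt : ∀ x, v x ≠ ⊤ := fun x => ((W.Gr_le x z').trans_lt hK.lt_top).ne
  have hu0 : ∀ x, u x ≠ 0 := fun x =>
    ((pos_iff_ne_zero.2 (pow_ne_zero _ hc)).trans_le (Gr_pos H W.low h0 x z)).ne'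
  have hv0 : ∀ x, v x ≠ 0 := fun x =>
    ((pos_iff_ne_zero.2 (pow_ne_zero _ hc)).trans_le (Gr_pos H W.low h0 x z')).ne'
  have uex : ∀ k, k ≤ n0 → ∀ x ∈ Ω k, u x = ∑' w, Hk R (Ω k) x w * u w :=
    fun k hk x hx => Gr_exit hx (zout k hk)
  have vex : ∀ k, k ≤ n0 → ∀ x ∈ Ω k, v x = ∑' w, Hk R (Ω k) x w * v w :=
    fun k hk x hx => Gr_exit hx (zout' k hk)
  -- initial step
  set y0 := Y (r + 1 + 2 * n + 1) with hy0
  have hk0 : r + 1 + 2 * n + 1 ≤ n0 := by omega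
  set A0 : ℝ≥0∞ := u y0 / (v y0 * (C * K)) with hA0
  have hden0 : v y0 * (C * K) ≠ 0 := mul_ne_zero (hv0 _) hCK0
  have hdent : v y0 * (C * K) ≠ ⊤ := ENNReal.mul_ne_top (hvt _) hCKt
  have hA0t : A0 ≠ ⊤ := ENNReal.div_ne_top (hut _) hden0
  have hstart : ∀ x ∈ Ω (r + 1 + 2 * n), A0 * v x ≤ u x ∧ u x ≤ (C * K) ^ 2 * A0 * v x := by
    intro x hx
    have hx2 := incl _ hk0 hx
    have e1 := compare_init (φ := Ker.Gr (kin R (Ω (r + 1 + 2 * n + 1))) x y0) u v (hup _ hk0 x hx) (hlo _ x)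
    have e2 := compare_init (φ := Ker.Gr (kin R (Ω (r + 1 + 2 * n + 1))) x y0) v u (hup _ hk0 x hx) (hlo _ x)
    rw [← uex _ hk0 x hx2, ← vex _ hk0 x hx2, ← uex _ hk0 _ (yin _), ← vex _ hk0 _ (yin _)] at e1 e2
    constructor
    · rw [hA0, ENNReal.div_eq_inv_mul, mul_assoc]
      rw [ENNReal.inv_mul_le_iff hden0 hdent]
      calc u y0 * v x = v x * u y0 := mul_comm _ _
        _ ≤ _ := e2
        _ = _ := by ring
    · have hAe : A0 * (v y0 * (C * K)) = u y0 := ENNReal.div_mul_cancel hden0 hdent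
      have : u x * v y0 ≤ (C * K) ^ 2 * A0 * v x * v y0 := by
        refine e1.trans (le_of_eq ?_)
        change C * K * (v x * u y0) = _
        rw [← hAe]; ring
      exact (ENNReal.mul_le_mul_iff_left (hv0 y0) (hvt y0)).1 this
  set L0 := (C * K) ^ 2 * A0 with hL0
  have hL0t : L0 ≠ ⊤ := ENNReal.mul_ne_top (ENNReal.pow_ne_top hCKt) hA0t
  have hq1 : q ≤ 1 := tsub_le_self
  have hqt : ∀ j, q ^ j * L0 ≠ ⊤ := fun j =>
    ENNReal.mul_ne_top (ENNReal.pow_ne_top (hq1.trans_lt ENNReal.one_lt_top).ne) hL0t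
  have iter : ∀ j, j ≤ n → ∃ A, A0 ≤ A ∧ A ≠ ⊤ ∧ ∀ x ∈ Ω (r + 1 + 2 * (n - j)),
      A * v x ≤ u x ∧ u x ≤ (A + q ^ j * L0) * v x := by
    intro j
    induction j with
    | zero =>
      intro _
      refine ⟨A0, le_rfl, hA0t, fun x hx => ?_⟩
      obtain ⟨i1, i2⟩ := hstart x hx
      refine ⟨i1, i2.trans ?_⟩
      rw [pow_zero, one_mul]
      exact mul_le_mul' le_add_self le_rfl
    | succ j ih =>
      intro hj
      obtain ⟨A, hA1, hA2, hA3⟩ := ih (by omega)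
      set k := r + 1 + 2 * (n - (j + 1)) with hk
      have hk2 : r + 1 + 2 * (n - j) = k + 2 := by omega
      rw [hk2] at hA3
      have hkn : k + 1 ≤ n0 := by omega
      have hkn2 : k + 2 ≤ n0 := by omega
      have hins : ∀ x ∈ insert (Y (k+1)) (Ω k), x ∈ Ω (k+1) := by
        intro x hx
        rcases hx with rfl | hx
        · exact yin _
        · exact incl k hkn hx
      obtain ⟨A', h1, h2, h3⟩ := contract (H := Hk R (Ω (k+1))) (Ωm := Ω k) (y := Y (k+1))
        (φ := fun x => Ker.Gr (kin R (Ω (k+1))) x (Y (k+1))) hC hK hCK hut hvt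
        (hup k hkn) (fun x _ => hlo _ x)
        (fun x hx => uex _ hkn x (hins x hx)) (fun x hx => vex _ hkn x (hins x hx)) hA2 (hqt j) (by
          intro x hx w hw
          obtain ⟨hw1, w', hw', hRw⟩ := Hk_ne (hins x hx) hw
          apply hA3
          have := push (k+1) hkn2 w' hw' w (W.range _ _ hRw)
          rw [mem]
          have : gr d (Y (k + 2)) w z ≤ δ := this
          linarith)
      refine ⟨A', hA1.trans h1, h2, fun x hx => ?_⟩
      obtain ⟨i1, i2⟩ := h3 x hx
      refine ⟨i1, i2.trans (le_of_eq ?_)⟩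
      rw [pow_succ', mul_assoc]
  obtain ⟨A, hA1, hA2, hA3⟩ := iter n le_rfl
  -- balls are inside
  have ball : ∀ x, d o x ≤ r → x ∈ Ω (r + 1 + 2 * (n - n)) := by
    intro x hx
    have e : r + 1 + 2 * (n - n) = r + 1 := by omega
    rw [e, mem]
    have hkn : r + 1 ≤ n0 := by omega
    obtain ⟨i1, i2⟩ := Y1 (r+1) hkn
    have hxr : (d o x : ℝ) ≤ r := by exact_mod_cast hx
    have h1 := H.hyp (Y (r+1)) o x z
    have h2 : gr d (Y (r+1)) o z = 0 := by
      have hs : (d z (Y (r+1)) : ℝ) = d (Y (r+1)) z := by rw [H.symm]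
      simp only [gr]; linarith
    have hN : (0 : ℝ) ≤ N := Nat.cast_nonneg _
    have h3 : δ < gr d (Y (r+1)) o x := by
      have t := H.triR o x (Y (r+1))
      have hr : (0 : ℝ) ≤ r := Nat.cast_nonneg _
      have : (r : ℝ) * 1 ≤ r * D := by gcongr; linarith
      simp only [gr]
      push_cast at i1
      nlinarith
    by_contra hcon
    push Not at hcon
    have : δ < min (gr d (Y (r+1)) o x) (gr d (Y (r+1)) x z) := lt_min h3 (by linarith)
    linarith
  obtain ⟨-, j2⟩ := hA3 x (ball x hx)
  obtain ⟨j1, -⟩ := hA3 x' (ball x' hx')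
  calc u x * v x' ≤ (A + q ^ n * L0) * v x * v x' := by gcongr
    _ ≤ (A + q ^ n * ((C * K) ^ 2 * A)) * v x * v x' := by
        rw [hL0]; gcongr
    _ = (1 + q ^ n * (C * K) ^ 2) * (v x * (A * v x')) := by ring
    _ ≤ (1 + q ^ n * (C * K) ^ 2) * (v x * u x') := by gcongr

end HolderAbs

/-! ### The word metric -/

section WordMetric
variable {Γ : Type} [Group Γ] {S : Set Γ}

theorem wl_le (w : List Γ) (hw : ∀ x ∈ w, x ∈ S) : wl S w.prod ≤ w.length :=
  Nat.sInf_le ⟨w, rfl, hw, rfl⟩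

theorem wl_spec (hS : IsGenSet S) (g : Γ) :
    ∃ w : List Γ, w.length = wl S g ∧ (∀ x ∈ w, x ∈ S) ∧ w.prod = g := by
  have hne : {n : ℕ | ∃ w : List Γ, w.length = n ∧ (∀ x ∈ w, x ∈ S) ∧ w.prod = g}.Nonempty := by
    have hg : g ∈ (Subgroup.closure S).toSubmonoid := by rw [hS.2.2]; trivial
    rw [Subgroup.closure_toSubmonoid] at hg
    obtain ⟨l, hl, hp⟩ := Submonoid.exists_list_of_mem_closure hg
    refine ⟨l.length, l, rfl, fun x hx => ?_, hp⟩
    rcases hl x hx with h | h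
    · exact h
    · have := hS.2.1 _ h
      rwa [inv_inv] at this
  exact Nat.sInf_mem hne

theorem wl_one : wl S (1 : Γ) = 0 := by
  have := wl_le (S := S) ([] : List Γ) (by simp)
  simpa using this

theorem wl_mul (hS : IsGenSet S) (g h : Γ) : wl S (g * h) ≤ wl S g + wl S h := by
  obtain ⟨w, h1, h2, h3⟩ := wl_spec hS g
  obtain ⟨w', h1', h2', h3'⟩ := wl_spec hS h
  have := wl_le (S := S) (w ++ w') (by
    intro x hx
    rcases List.mem_append.1 hx with h | h
    · exact h2 x h
    · exact h2' x h)
  rw [List.prod_append, List.length_append, h3, h3', h1, h1'] at this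
  exact this

theorem wl_inv_le (hS : IsGenSet S) (g : Γ) : wl S g⁻¹ ≤ wl S g := by
  obtain ⟨w, h1, h2, h3⟩ := wl_spec hS g
  have := wl_le (S := S) (w.map (·⁻¹)).reverse (by
    intro x hx
    simp only [List.mem_reverse, List.mem_map] at hx
    obtain ⟨a, ha, rfl⟩ := hx
    exact hS.2.1 a (h2 a ha))
  rw [← List.prod_inv_reverse, h3] at this
  simpa [h1] using this

theorem wl_inv (hS : IsGenSet S) (g : Γ) : wl S g⁻¹ = wl S g :=
  le_antisymm (wl_inv_le hS g) (by simpa using wl_inv_le hS g⁻¹)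

theorem wl_eq_zero (hS : IsGenSet S) {g : Γ} (h : wl S g = 0) : g = 1 := by
  obtain ⟨w, h1, h2, h3⟩ := wl_spec hS g
  rw [h] at h1
  rw [List.length_eq_zero_iff.1 h1] at h3
  simpa using h3.symm

theorem wl_eq_one (hS : IsGenSet S) {g : Γ} (h : wl S g = 1) : g ∈ S := by
  obtain ⟨w, h1, h2, h3⟩ := wl_spec hS g
  rw [h] at h1
  obtain ⟨a, rfl⟩ := List.length_eq_one_iff.1 h1
  rw [← h3]; simpa using h2 a (by simp)

theorem wl_gen {g : Γ} (h : g ∈ S) : wl S g ≤ 1 := by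
  have := wl_le (S := S) [g] (by simpa using h)
  simpa using this

theorem wl_ball_finite (hS : IsGenSet S) (n : ℕ) : {g : Γ | wl S g ≤ n}.Finite := by
  classical
  induction n with
  | zero =>
    refine (Set.finite_singleton (1 : Γ)).subset fun g hg => ?_
    exact wl_eq_zero hS (Nat.le_zero.1 hg)
  | succ n ih =>
    have hf : (Set.insert 1 ((fun p : Γ × Γ => p.1 * p.2) '' (S ×ˢ {g : Γ | wl S g ≤ n}))).Finite :=
      (((hS.1).prod ih).image _).insert 1
    refine hf.subset fun g hg => ?_
    obtain ⟨w, h1, h2, h3⟩ := wl_spec hS g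
    cases w with
    | nil => left; simpa using h3.symm
    | cons a w =>
      right
      refine ⟨(a, w.prod), ⟨h2 a (by simp), ?_⟩, by simpa using h3⟩
      have := wl_le (S := S) w (fun x hx => h2 x (by simp [hx]))
      have hg' : wl S g ≤ n + 1 := hg
      simp only [List.length_cons] at h1
      show wl S w.prod ≤ n
      omega

theorem wdist_left (g x y : Γ) : wdist S (g * x) (g * y) = wdist S x y := by
  simp only [wdist]; congr 1; group

theorem wdist_symm (hS : IsGenSet S) (x y : Γ) : wdist S x y = wdist S y x := by
  simp only [wdist]; rw [← wl_inv hS]; congr 1; group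

theorem wdist_one (x : Γ) : wdist S 1 x = wl S x := by simp [wdist]

theorem wdist_mul (x h : Γ) : wdist S x (x * h) = wl S h := by simp [wdist]

theorem wdist_zero (hS : IsGenSet S) (x y : Γ) (h : wdist S x y = 0) : x = y := by
  have := wl_eq_zero hS h
  rwa [inv_mul_eq_one] at this

theorem gr_left (g m x y : Γ) : gr (wdist S) (g * m) (g * x) (g * y) = gr (wdist S) m x y := by
  simp only [gr, wdist_left]

theorem hyp_word (hS : IsGenSet S) {δ : ℝ} (hδ : IsHyperbolic S δ) : Hyp (wdist S) (max δ 1) where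
  self := fun x => by simp [wdist, wl_one]
  symm := wdist_symm hS
  tri := fun x y z => by
    simp only [wdist]
    have := wl_mul hS (x⁻¹ * y) (y⁻¹ * z)
    rwa [show x⁻¹ * y * (y⁻¹ * z) = x⁻¹ * z by group] at this
  delta := le_max_right _ _
  hyp := fun m x y z => by
    have h := hδ.2 (m⁻¹ * x) (m⁻¹ * z) (m⁻¹ * y)
    have e : ∀ a b : Γ, gp S 1 (m⁻¹ * a) (m⁻¹ * b) = gr (wdist S) m a b := by
      intro a b
      rw [← gr_left m⁻¹ m a b, inv_mul_cancel]; rfl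
    rw [e, e, e] at h
    have e2 : gr (wdist S) m y z = gr (wdist S) m z y := by
      simp only [gr]; rw [wdist_symm hS y z]; ring
    rw [e2]
    have := le_max_left δ 1
    linarith
  geo := fun x y i hi => by
    obtain ⟨w, h1, h2, h3⟩ := wl_spec hS (x⁻¹ * y)
    have hw : w.length = wdist S x y := h1
    have hy : x * w.prod = y := by rw [h3]; group
    have a1 := wl_le (S := S) (w.take i) (fun a ha => h2 a (List.mem_of_mem_take ha))
    have a2 := wl_le (S := S) (w.drop i) (fun a ha => h2 a (List.mem_of_mem_drop ha))
    have e1 : wdist S x (x * (w.take i).prod) = wl S (w.take i).prod := wdist_mul _ _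
    have e2 : wdist S (x * (w.take i).prod) y = wl S (w.drop i).prod := by
      rw [← hy, ← List.prod_take_mul_prod_drop w i, ← mul_assoc, wdist_mul]
    have a3 := wl_mul hS (w.take i).prod (w.drop i).prod
    rw [List.prod_take_mul_prod_drop, h3] at a3
    have a3' : wdist S x y ≤ wl S (w.take i).prod + wl S (w.drop i).prod := a3
    rw [List.length_take] at a1
    rw [List.length_drop] at a2
    refine ⟨x * (w.take i).prod, ?_, ?_⟩ <;> omega

end WordMetric

/-! ### Spectral gap from a paradoxical family of children -/

section Gap
variable {V : Type}

theorem var_real (s : Finset V) (r f : V → ℝ) (hr : ∀ w, 0 ≤ r w) (hs : ∑ w ∈ s, r w = 1) (y : V)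
    (hy : y ∈ s) (c0 : ℝ) (hc0 : 0 ≤ c0) (hry : c0 ≤ r y) :
    (1 + c0 / 2) * (∑ w ∈ s, r w * f w) ^ 2 ≤ c0 * f y ^ 2 + ∑ w ∈ s, r w * f w ^ 2 := by
  set m := ∑ w ∈ s, r w * f w with hm
  have h1 : ∑ w ∈ s, r w * (f w - m) ^ 2 = ∑ w ∈ s, r w * f w ^ 2 - m ^ 2 := by
    have : ∀ w, r w * (f w - m) ^ 2 = r w * f w ^ 2 - 2 * m * (r w * f w) + m ^ 2 * r w := by
      intro w; ring
    simp only [this, Finset.sum_add_distrib, Finset.sum_sub_distrib, ← Finset.mul_sum, hs, ← hm]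
    ring
  have h2 : r y * (f y - m) ^ 2 ≤ ∑ w ∈ s, r w * (f w - m) ^ 2 :=
    Finset.single_le_sum (f := fun w => r w * (f w - m) ^ 2)
      (fun w _ => mul_nonneg (hr w) (sq_nonneg _)) hy
  have h3 : c0 * (f y - m) ^ 2 ≤ r y * (f y - m) ^ 2 := by gcongr
  have h4 : c0 * (m ^ 2 / 2 - f y ^ 2) ≤ c0 * (f y - m) ^ 2 := by
    gcongr; nlinarith [sq_nonneg (m - 2 * f y)]
  nlinarith

theorem var_enn (R f : V → ℝ≥0∞) (hfin : {w | R w ≠ 0}.Finite) (hsum : ∑' w, R w = 1)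
    (hf : ∀ w, f w ≠ ⊤) (y : V) (c0 : ℝ≥0∞) (hc : c0 ≠ 0) (hy : c0 ≤ R y) :
    (1 + c0 / 2) * (∑' w, R w * f w) ^ 2 ≤ c0 * f y ^ 2 + ∑' w, R w * f w ^ 2 := by
  classical
  set s := hfin.toFinset with hs
  have hz : ∀ w, w ∉ s → R w = 0 := by
    intro w hw; by_contra h; exact hw (by simp [hs, h])
  have hR1 : ∀ w, R w ≤ 1 := fun w => by rw [← hsum]; exact ENNReal.le_tsum w
  have hRt : ∀ w, R w ≠ ⊤ := fun w => ((hR1 w).trans_lt ENNReal.one_lt_top).ne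
  have hct : c0 ≠ ⊤ := (hy.trans_lt (hRt y).lt_top).ne
  have hys : y ∈ s := by
    by_contra h
    exact hc (le_antisymm (hy.trans (hz y h).le) (zero_le))
  rw [tsum_eq_sum (s := s) (fun w hw => hz w hw)] at hsum
  rw [tsum_eq_sum (s := s) (fun w hw => by rw [hz w hw, zero_mul]),
    tsum_eq_sum (s := s) (fun w hw => by rw [hz w hw, zero_mul])]
  have hreal := var_real s (fun w => (R w).toReal) (fun w => (f w).toReal)
    (fun w => ENNReal.toReal_nonneg) (by
      rw [← ENNReal.toReal_sum (fun w _ => hRt w), hsum]; simp) y hys c0.toReal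
      ENNReal.toReal_nonneg (ENNReal.toReal_mono (hRt y) hy)
  have t1 : ∑ w ∈ s, R w * f w ≠ ⊤ := ENNReal.sum_ne_top.2 fun w _ => ENNReal.mul_ne_top (hRt w) (hf w)
  have t2 : ∑ w ∈ s, R w * f w ^ 2 ≠ ⊤ :=
    ENNReal.sum_ne_top.2 fun w _ => ENNReal.mul_ne_top (hRt w) (ENNReal.pow_ne_top (hf w))
  have t3 : c0 / 2 ≠ ⊤ := ENNReal.div_ne_top hct two_ne_zero
  have t4 : c0 * f y ^ 2 ≠ ⊤ := ENNReal.mul_ne_top hct (ENNReal.pow_ne_top (hf y))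
  rw [← ENNReal.toReal_le_toReal (ENNReal.mul_ne_top (ENNReal.add_ne_top.2 ⟨ENNReal.one_ne_top, t3⟩)
    (ENNReal.pow_ne_top t1)) (ENNReal.add_ne_top.2 ⟨t4, t2⟩)]
  rw [ENNReal.toReal_mul, ENNReal.toReal_add ENNReal.one_ne_top t3, ENNReal.toReal_pow,
    ENNReal.toReal_add t4 t2, ENNReal.toReal_sum (fun w _ => ENNReal.mul_ne_top (hRt w) (hf w)),
    ENNReal.toReal_sum (fun w _ => ENNReal.mul_ne_top (hRt w) (ENNReal.pow_ne_top (hf w)))]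
  simp only [ENNReal.toReal_mul, ENNReal.toReal_pow, ENNReal.toReal_div, ENNReal.toReal_one,
    ENNReal.toReal_ofNat]
  exact hreal

open Classical in
theorem gap_step (R : Ker V) (hfin : ∀ x, {w | R x w ≠ 0}.Finite) (hrow : ∀ x, ∑' w, R x w = 1)
    (hcol : ∀ w, ∑' x, R x w = 1) (Ch : V → Finset V) (M1 M2 : ℕ) (hM1 : ∀ x, (Ch x).card = M1)
    (hM2 : ∀ y, ∑' x, (if y ∈ Ch x then (1 : ℝ≥0∞) else 0) ≤ M2) (hM : 4 * M2 ≤ M1) (hM0 : M1 ≠ 0)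
    (c0 : ℝ≥0∞) (hc : c0 ≠ 0) (hCh : ∀ x, ∀ y ∈ Ch x, c0 ≤ R x y)
    (f : V → ℝ≥0∞) (hf : ∀ w, f w ≠ ⊤) :
    (1 + c0 / 2) * ∑' x, (∑' w, R x w * f w) ^ 2 ≤ (1 + c0 / 4) * ∑' w, f w ^ 2 := by
  have hp : ∀ x, M1 * ((1 + c0 / 2) * (∑' w, R x w * f w) ^ 2) ≤
      c0 * (∑' y, (if y ∈ Ch x then 1 else 0) * f y ^ 2) + M1 * ∑' w, R x w * f w ^ 2 := by
    intro x
    have h1 : ∀ y ∈ Ch x, (1 + c0 / 2) * (∑' w, R x w * f w) ^ 2 ≤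
        c0 * f y ^ 2 + ∑' w, R x w * f w ^ 2 := fun y hy =>
      var_enn (R x) f (hfin x) (hrow x) hf y c0 hc (hCh x y hy)
    have h2 := Finset.sum_le_sum h1
    rw [Finset.sum_const, Finset.sum_add_distrib, Finset.sum_const, hM1, nsmul_eq_mul, nsmul_eq_mul,
      ← Finset.mul_sum] at h2
    have h3 : (∑' y, (if y ∈ Ch x then 1 else 0) * f y ^ 2) = ∑ y ∈ Ch x, f y ^ 2 := by
      rw [tsum_eq_sum (s := Ch x) (fun y hy => by simp [hy])]
      exact Finset.sum_congr rfl fun y hy => by simp [hy]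
    rw [h3]; exact h2
  have hsum := ENNReal.tsum_le_tsum hp
  rw [ENNReal.tsum_mul_left, ENNReal.tsum_mul_left, ENNReal.tsum_add, ENNReal.tsum_mul_left,
    ENNReal.tsum_mul_left] at hsum
  have e1 : ∑' x, ∑' y, (if y ∈ Ch x then 1 else 0) * f y ^ 2 ≤ M2 * ∑' y, f y ^ 2 := by
    rw [ENNReal.tsum_comm, ← ENNReal.tsum_mul_left]
    refine ENNReal.tsum_le_tsum fun y => ?_
    rw [ENNReal.tsum_mul_right]
    exact mul_le_mul' (hM2 y) le_rfl
  have e2 : ∑' x, ∑' w, R x w * f w ^ 2 = ∑' w, f w ^ 2 := by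
    rw [ENNReal.tsum_comm]
    refine tsum_congr fun w => ?_
    rw [ENNReal.tsum_mul_right, hcol, one_mul]
  rw [e2] at hsum
  set F := ∑' w, f w ^ 2 with hF
  set G := ∑' x, (∑' w, R x w * f w) ^ 2 with hG
  have hM1' : (M1 : ℝ≥0∞) ≠ 0 := by exact_mod_cast hM0
  have hM4 : (M2 : ℝ≥0∞) ≤ M1 * (4 : ℝ≥0∞)⁻¹ := by
    rw [← ENNReal.div_eq_inv_mul.trans (mul_comm _ _), ENNReal.le_div_iff_mul_le (by simp) (by simp)]
    rw [mul_comm]; exact_mod_cast hM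
  have : (M1 : ℝ≥0∞) * ((1 + c0 / 2) * G) ≤ M1 * ((1 + c0 / 4) * F) := by
    calc _ ≤ _ := hsum
      _ ≤ c0 * (M1 * (4 : ℝ≥0∞)⁻¹ * F) + M1 * F := by
          gcongr
          exact e1.trans (by gcongr)
      _ = _ := by rw [div_eq_mul_inv]; ring
  exact (ENNReal.mul_le_mul_iff_right hM1' (ENNReal.natCast_ne_top _)).1 this

open Classical in
theorem decay_abs (R : Ker V) (hfin : ∀ x, {w | R x w ≠ 0}.Finite) (hrow : ∀ x, ∑' w, R x w = 1)
    (hcol : ∀ w, ∑' x, R x w = 1) (Ch : V → Finset V) (M1 M2 : ℕ) (hM1 : ∀ x, (Ch x).card = M1)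
    (hM2 : ∀ y, ∑' x, (if y ∈ Ch x then (1 : ℝ≥0∞) else 0) ≤ M2) (hM : 4 * M2 ≤ M1) (hM0 : M1 ≠ 0)
    (c0 : ℝ≥0∞) (hc : c0 ≠ 0) (hct : c0 ≠ ⊤) (hCh : ∀ x, ∀ y ∈ Ch x, c0 ≤ R x y) :
    ∃ ρ : ℝ≥0∞, ρ < 1 ∧ ∀ n x y, (R ^ n) x y ≤ ρ ^ n := by
  have hpow1 : ∀ n x, ∑' w, (R ^ n) x w = 1 := by
    intro n
    induction n with
    | zero => intro x; simp [Ker.one_app]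
    | succ n ih =>
      intro x
      simp only [pow_succ, Ker.mul_app]
      rw [ENNReal.tsum_comm]
      simp only [ENNReal.tsum_mul_left, hrow, mul_one, ih]
  have hpt : ∀ n x w, (R ^ n) x w ≠ ⊤ := fun n x w =>
    ((ENNReal.le_tsum (f := fun w => (R ^ n) x w) w).trans_lt (by rw [hpow1]; exact ENNReal.one_lt_top)).ne
  set q : ℝ≥0∞ := (1 + c0 / 4) / (1 + c0 / 2) with hq
  have h2t : c0 / 2 ≠ ⊤ := ENNReal.div_ne_top hct two_ne_zero
  have h12 : (1 + c0 / 2) ≠ ⊤ := ENNReal.add_ne_top.2 ⟨ENNReal.one_ne_top, h2t⟩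
  have h120 : (1 + c0 / 2) ≠ 0 := by simp
  have hq1 : q < 1 := by
    rw [hq, ENNReal.div_lt_iff (Or.inl h120) (Or.inl h12), one_mul]
    refine ENNReal.add_lt_add_left ENNReal.one_ne_top ?_
    rw [div_eq_mul_inv, div_eq_mul_inv]
    refine (ENNReal.mul_lt_mul_iff_right hc hct).2 ?_
    rw [ENNReal.inv_lt_inv]
    norm_num
  have hstep : ∀ f : V → ℝ≥0∞, (∀ w, f w ≠ ⊤) →
      ∑' x, (∑' w, R x w * f w) ^ 2 ≤ q * ∑' w, f w ^ 2 := by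
    intro f hf
    have := gap_step R hfin hrow hcol Ch M1 M2 hM1 hM2 hM hM0 c0 hc hCh f hf
    rw [hq, ENNReal.div_eq_inv_mul, mul_assoc, ← ENNReal.div_eq_inv_mul, ENNReal.le_div_iff_mul_le (Or.inl h120) (Or.inl h12), mul_comm]
    exact this
  have hiter : ∀ n y, ∑' x, ((R ^ n) x y) ^ 2 ≤ q ^ n := by
    intro n y
    induction n with
    | zero =>
      simp only [pow_zero, Ker.one_app]
      rw [tsum_eq_single y (fun x hx => by simp [hx])]; simp
    | succ n ih =>
      simp only [pow_succ' R, Ker.mul_app]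
      refine (hstep (fun w => (R ^ n) w y) (fun w => hpt n w y)).trans ?_
      rw [pow_succ']; exact mul_le_mul' le_rfl ih
  refine ⟨q ^ (1 / 2 : ℝ), ENNReal.rpow_lt_one hq1 (by norm_num), fun n x y => ?_⟩
  have h1 : ((R ^ n) x y) ^ 2 ≤ q ^ n :=
    (ENNReal.le_tsum (f := fun x => ((R ^ n) x y) ^ 2) x).trans (hiter n y)
  have h2 : q ^ n = ((q ^ (1 / 2 : ℝ)) ^ n) ^ 2 := by
    rw [← pow_mul, mul_comm, pow_mul, ← ENNReal.rpow_natCast (q ^ (1 / 2 : ℝ)) 2, ← ENNReal.rpow_mul]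
    norm_num
  rw [h2] at h1
  exact (ENNReal.pow_le_pow_left_iff two_ne_zero).1 h1

end Gap

/-! ### Construction of the children -/

section Children
variable {Γ : Type} [Group Γ] {S : Set Γ} {δ : ℝ}

theorem gr_symm (H : Hyp (wdist S) δ) (m x y : Γ) : gr (wdist S) m x y = gr (wdist S) m y x := by
  simp only [gr]; rw [H.symm x y]; ring

theorem gr_swap (H : Hyp (wdist S) δ) (x x' y : Γ) :
    gr (wdist S) x x' y = wdist S x x' - gr (wdist S) x' x y := by
  simp only [gr]; rw [H.symm x' x, H.symm y x, H.symm y x']; ring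

theorem sep_seq (H : Hyp (wdist S) δ) {u v : ℕ → Γ} (hu : ConvInf S u) (hv : ConvInf S v)
    (h : ¬ EquivSeq S u v) : ∃ κ : ℝ, ∀ᶠ n in atTop, gr (wdist S) 1 (u n) (v n) ≤ κ := by
  unfold EquivSeq at h
  rw [tendsto_atTop] at h
  push Not at h
  obtain ⟨b, hb⟩ := h
  have hu' := (tendsto_atTop.1 hu) (b + 2 * δ)
  have hv' := (tendsto_atTop.1 hv) (b + 2 * δ)
  obtain ⟨n1, h1⟩ := eventually_atTop.1 hu'
  obtain ⟨n2, h2⟩ := eventually_atTop.1 hv'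
  refine ⟨b + 2 * δ, ?_⟩
  set n := max (max n1.1 n1.2) (max n2.1 n2.2) with hn
  filter_upwards [eventually_ge_atTop n] with m hm
  by_contra hcon
  push Not at hcon
  have hfr := hb
  rw [frequently_atTop] at hfr
  obtain ⟨p, hp, hpb⟩ := hfr (n, n)
  have hp1 : n ≤ p.1 := hp.1
  have hp2 : n ≤ p.2 := hp.2
  have hδ := H.delta
  have g1 : b + 2 * δ ≤ gr (wdist S) 1 (u p.1) (u m) := h1 (p.1, m)
    ⟨by show n1.1 ≤ p.1; omega, by show n1.2 ≤ m; omega⟩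
  have g2 : b + 2 * δ ≤ gr (wdist S) 1 (v m) (v p.2) := h2 (m, p.2)
    ⟨by show n2.1 ≤ m; omega, by show n2.2 ≤ p.2; omega⟩
  have a1 := H.hyp 1 (u m) (v m) (v p.2)
  have a2 := H.hyp 1 (u p.1) (u m) (v p.2)
  have b1 : b + 2 * δ ≤ min (gr (wdist S) 1 (u m) (v m)) (gr (wdist S) 1 (v m) (v p.2)) :=
    le_min hcon.le g2
  have b2 : b + δ ≤ min (gr (wdist S) 1 (u p.1) (u m)) (gr (wdist S) 1 (u m) (v p.2)) :=
    le_min (by linarith) (by linarith)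
  have hpb' : gr (wdist S) 1 (u p.1) (v p.2) < b := hpb
  linarith

theorem exists_triple (H : Hyp (wdist S) δ) (B : Boundary Γ S) (ξ : Fin 3 → B.pt)
    (hξ : Function.Injective ξ) : ∃ κ : ℝ, 0 ≤ κ ∧ ∀ D : ℕ, ∃ a : Fin 3 → Γ,
      (∀ i, D ≤ wl S (a i)) ∧ ∀ i j, i ≠ j → gr (wdist S) 1 (a i) (a j) ≤ κ := by
  choose U hU1 hU2 using fun i => B.cls_surj (ξ i)
  have hsep : ∀ i j, ∃ κ : ℝ, i ≠ j → ∀ᶠ n in atTop, gr (wdist S) 1 (U i n) (U j n) ≤ κ := by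
    intro i j
    by_cases hij : i = j
    · exact ⟨0, fun h => absurd hij h⟩
    · obtain ⟨κ, hκ⟩ := sep_seq H (hU1 i) (hU1 j) (by
        rw [← B.cls_eq _ _ (hU1 i) (hU1 j), hU2, hU2]
        exact fun h => hij (hξ h))
      exact ⟨κ, fun _ => hκ⟩
  choose κ hκ using hsep
  refine ⟨∑ i, ∑ j, |κ i j|, by positivity, fun D => ?_⟩
  have e1 : ∀ᶠ n in atTop, ∀ i, D ≤ wl S (U i n) := by
    rw [eventually_all]
    intro i
    have h := (tendsto_atTop.1 (hU1 i)) (D : ℝ)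
    obtain ⟨m, hm⟩ := eventually_atTop.1 h
    filter_upwards [eventually_ge_atTop (max m.1 m.2)] with n hn
    have := hm (n, n) ⟨by show m.1 ≤ n; omega, by show m.2 ≤ n; omega⟩
    simp only [gp] at this
    have hs : wdist S (U i n) (U i n) = 0 := H.self _
    have hw : wdist S (U i n) 1 = wl S (U i n) := by rw [H.symm, wdist_one]
    rw [hs, hw] at this
    have : (D : ℝ) ≤ wl S (U i n) := by push_cast at this; linarith
    exact_mod_cast this
  have e2 : ∀ᶠ n in atTop, ∀ i j, i ≠ j → gr (wdist S) 1 (U i n) (U j n) ≤ κ i j := by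
    rw [eventually_all]; intro i
    rw [eventually_all]; intro j
    by_cases hij : i = j
    · exact Eventually.of_forall fun n h => absurd hij h
    · filter_upwards [hκ i j hij] with n hn _ using hn
  obtain ⟨n, h1, h2⟩ := (e1.and e2).exists
  refine ⟨fun i => U i n, h1, fun i j hij => (h2 i j hij).trans ?_⟩
  calc κ i j ≤ |κ i j| := le_abs_self _
    _ ≤ ∑ j, |κ i j| := Finset.single_le_sum (f := fun j => |κ i j|) (fun _ _ => abs_nonneg _) (Finset.mem_univ j)
    _ ≤ _ := Finset.single_le_sum (f := fun i => ∑ j, |κ i j|)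
        (fun _ _ => Finset.sum_nonneg fun _ _ => abs_nonneg _) (Finset.mem_univ i)

open Classical in
/-- Descendants of generation `k`. -/
noncomputable def Dk (S : Set Γ) (κ1 : ℝ) (a : Fin 3 → Γ) : ℕ → Γ → Finset Γ
  | 0 => fun x => {x}
  | k + 1 => fun x => (Finset.univ.filter fun i => gr (wdist S) x 1 (x * a i) ≤ κ1).biUnion
      fun i => Dk S κ1 a k (x * a i)

theorem Dk_mem_succ {κ1 : ℝ} {a : Fin 3 → Γ} {k : ℕ} {x y : Γ} (h : y ∈ Dk S κ1 a (k + 1) x) :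
    ∃ i, gr (wdist S) x 1 (x * a i) ≤ κ1 ∧ y ∈ Dk S κ1 a k (x * a i) := by
  simpa [Dk] using h

theorem Dk_geom (H : Hyp (wdist S) δ) {κ1 : ℝ} (hκ1 : 0 ≤ κ1) {a : Fin 3 → Γ} {D W : ℕ}
    (hD : ∀ i, D ≤ wl S (a i)) (hW : ∀ i, wl S (a i) ≤ W) (hDb : 2 * κ1 + 3 * δ < D) :
    ∀ k x y, y ∈ Dk S κ1 a k x → gr (wdist S) x 1 y ≤ κ1 + δ ∧ wdist S x y ≤ k * W := by
  have hδ := H.delta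
  intro k
  induction k with
  | zero =>
    intro x y hy
    have : y = x := by simpa [Dk] using hy
    subst this
    refine ⟨?_, by simp [H.self]⟩
    simp only [gr, H.self]; push_cast; linarith
  | succ k ih =>
    intro x y hy
    obtain ⟨i, hi, hy'⟩ := Dk_mem_succ hy
    obtain ⟨j1, j2⟩ := ih _ _ hy'
    set x' := x * a i with hx'
    have hd : wdist S x x' = wl S (a i) := wdist_mul _ _
    have hdD : (D : ℝ) ≤ wdist S x x' := by rw [hd]; exact_mod_cast hD i
    constructor
    · have c1 : gr (wdist S) x' 1 x = wdist S x x' - gr (wdist S) x 1 x' := by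
        rw [gr_symm H x 1 x', gr_swap H x x' 1, gr_symm H x' x 1]; ring
      have c2 := H.hyp x' 1 x y
      have c3 : gr (wdist S) x' x y ≤ κ1 + 2 * δ := by
        by_contra hcon; push Not at hcon
        have : κ1 + 2 * δ < min (gr (wdist S) x' 1 x) (gr (wdist S) x' x y) :=
          lt_min (by linarith) hcon
        linarith
      have c4 := gr_swap H x x' y
      have c5 := H.hyp x 1 y x'
      by_contra hcon; push Not at hcon
      have : κ1 + δ < min (gr (wdist S) x 1 y) (gr (wdist S) x y x') := by
        refine lt_min hcon ?_
        rw [gr_symm H x y x']; linarith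
      linarith
    · have := H.tri x x' y
      have h2 := hW i
      have : (k + 1) * W = k * W + W := by ring
      omega

theorem Dk_card (H : Hyp (wdist S) δ) {κ : ℝ} (hκ : 0 ≤ κ) {a : Fin 3 → Γ} {D W : ℕ}
    (hD : ∀ i, D ≤ wl S (a i)) (hW : ∀ i, wl S (a i) ≤ W) (hDb : 2 * (κ + δ) + 3 * δ < D)
    (hsep : ∀ i j, i ≠ j → gr (wdist S) 1 (a i) (a j) ≤ κ) :
    ∀ k x, 2 ^ k ≤ (Dk S (κ + δ) a k x).card := by
  classical
  have hδ := H.delta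
  have hκ1 : 0 ≤ κ + δ := by linarith
  have hsep' : ∀ x i j, i ≠ j → gr (wdist S) x (x * a i) (x * a j) ≤ κ := by
    intro x i j hij
    have := gr_left (S := S) x 1 (a i) (a j)
    rw [mul_one] at this
    rw [this]; exact hsep i j hij
  -- from descendants of a good child
  have far : ∀ k x i y, gr (wdist S) x 1 (x * a i) ≤ κ + δ → y ∈ Dk S (κ + δ) a k (x * a i) →
      D - (κ + 3 * δ) ≤ gr (wdist S) x (x * a i) y := by
    intro k x i y hi hy'
    obtain ⟨j1, -⟩ := Dk_geom H hκ1 hD hW hDb k _ _ hy'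
    set x' := x * a i with hx'
    have hd : wdist S x x' = wl S (a i) := wdist_mul _ _
    have hdD : (D : ℝ) ≤ wdist S x x' := by rw [hd]; exact_mod_cast hD i
    have c1 : gr (wdist S) x' 1 x = wdist S x x' - gr (wdist S) x 1 x' := by
      rw [gr_symm H x 1 x', gr_swap H x x' 1, gr_symm H x' x 1]; ring
    have c2 := H.hyp x' 1 x y
    have c3 : gr (wdist S) x' x y ≤ κ + 3 * δ := by
      by_contra hcon; push Not at hcon
      have : κ + 3 * δ < min (gr (wdist S) x' 1 x) (gr (wdist S) x' x y) :=
        lt_min (by linarith) hcon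
      linarith
    have c4 := gr_swap H x x' y
    linarith
  intro k
  induction k with
  | zero => intro x; simp [Dk]
  | succ k ih =>
    intro x
    rw [Dk, Finset.card_biUnion]
    · have hcard : 2 ≤ (Finset.univ.filter fun i => gr (wdist S) x 1 (x * a i) ≤ κ + δ).card := by
        have h1 := Finset.card_filter_add_card_filter_not (s := (Finset.univ : Finset (Fin 3)))
          (fun i => gr (wdist S) x 1 (x * a i) ≤ κ + δ)
        have h2 : (Finset.univ.filter fun i => ¬ gr (wdist S) x 1 (x * a i) ≤ κ + δ).card ≤ 1 := by
          rw [Finset.card_le_one]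
          intro i hi j hj
          by_contra hij
          simp only [Finset.mem_filter, Finset.mem_univ, true_and, not_le] at hi hj
          have := H.hyp x (x * a i) 1 (x * a j)
          have h3 := hsep' x i j hij
          have : κ + δ < min (gr (wdist S) x (x * a i) 1) (gr (wdist S) x 1 (x * a j)) :=
            lt_min (by rw [gr_symm H]; exact hi) hj
          linarith
        simp only [Finset.card_univ, Fintype.card_fin] at h1
        omega
      calc 2 ^ (k + 1) = 2 * 2 ^ k := by ring
        _ ≤ (Finset.univ.filter fun i => gr (wdist S) x 1 (x * a i) ≤ κ + δ).card * 2 ^ k := by gcongr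
        _ ≤ _ := by
          rw [← smul_eq_mul]
          exact Finset.card_nsmul_le_sum _ _ _ fun i _ => ih _
    · intro i hi j hj hij
      rw [Function.onFun, Finset.disjoint_left]
      intro y hy1 hy2
      simp only [Finset.coe_filter, Finset.mem_univ, true_and, Set.mem_ofPred_eq] at hi hj
      have f1 := far k x i y hi hy1
      have f2 := far k x j y hj hy2
      have h3 := hsep' x i j hij
      have h4 := H.hyp x (x * a i) y (x * a j)
      have : D - (κ + 3 * δ) ≤ min (gr (wdist S) x (x * a i) y) (gr (wdist S) x y (x * a j)) :=
        le_min f1 (by rw [gr_symm H]; exact f2)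
      linarith

theorem mult_bound (hS : IsGenSet S) (H : Hyp (wdist S) δ) (κ2 : ℝ) : ∃ Bn : ℕ, ∀ (m : ℕ) (y : Γ),
    ∃ F : Finset Γ, F.card ≤ (m + 1) * Bn ∧
      ∀ x, gr (wdist S) x 1 y ≤ κ2 → wdist S x y ≤ m → x ∈ F := by
  classical
  set r2 : ℕ := ⌈2 * κ2 + 2 * δ⌉₊ with hr2
  set Bf := (wl_ball_finite hS r2).toFinset with hBf
  refine ⟨Bf.card, fun m y => ?_⟩
  have hc : ∀ j : ℕ, ∃ x0 : Γ, ∀ x, gr (wdist S) x 1 y ≤ κ2 → wdist S x y = j → wdist S x0 x ≤ r2 := by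
    intro j
    by_cases hex : ∃ x0, gr (wdist S) x0 1 y ≤ κ2 ∧ wdist S x0 y = j
    · obtain ⟨x0, h1, h2⟩ := hex
      refine ⟨x0, fun x g1 g2 => ?_⟩
      have e1 : gr (wdist S) y x 1 = wdist S x y - gr (wdist S) x 1 y := by
        rw [gr_swap H y x 1, gr_symm H x 1 y, H.symm y x]
      have e2 : gr (wdist S) y x0 1 = wdist S x0 y - gr (wdist S) x0 1 y := by
        rw [gr_swap H y x0 1, gr_symm H x0 1 y, H.symm y x0]
      have e3 := H.hyp y x0 1 x
      rw [gr_symm H y 1 x] at e3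
      have e4 : (j : ℝ) - κ2 ≤ min (gr (wdist S) y x0 1) (gr (wdist S) y x 1) := by
        rw [e1, e2, g2, h2]
        exact le_min (by linarith) (by linarith)
      have e5 : gr (wdist S) y x0 x = (j + j - wdist S x0 x) / 2 := by
        simp only [gr]; rw [h2, g2]
      have : (wdist S x0 x : ℝ) ≤ r2 := by
        have := Nat.le_ceil (2 * κ2 + 2 * δ)
        rw [hr2]; linarith
      exact_mod_cast this
    · exact ⟨1, fun x g1 g2 => absurd ⟨x, g1, g2⟩ hex⟩
  choose x0 hx0 using hc
  refine ⟨(Finset.range (m + 1)).biUnion fun j => Bf.image fun h => x0 j * h, ?_, ?_⟩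
  · refine Finset.card_biUnion_le.trans ?_
    calc ∑ j ∈ Finset.range (m + 1), (Bf.image fun h => x0 j * h).card
        ≤ ∑ j ∈ Finset.range (m + 1), Bf.card := Finset.sum_le_sum fun j _ => Finset.card_image_le
      _ = _ := by simp
  · intro x h1 h2
    rw [Finset.mem_biUnion]
    refine ⟨wdist S x y, by simpa [Nat.lt_succ_iff] using h2, ?_⟩
    rw [Finset.mem_image]
    refine ⟨(x0 (wdist S x y))⁻¹ * x, ?_, by group⟩
    have := hx0 _ x h1 rfl
    rw [hBf, Set.Finite.mem_toFinset]; exact this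

open Classical in
theorem exists_children (hS : IsGenSet S) (H : Hyp (wdist S) δ) {κ : ℝ} (hκ : 0 ≤ κ)
    (h3 : ∀ D : ℕ, ∃ a : Fin 3 → Γ,
      (∀ i, D ≤ wl S (a i)) ∧ ∀ i j, i ≠ j → gr (wdist S) 1 (a i) (a j) ≤ κ) :
    ∃ (Ch : Γ → Finset Γ) (M1 M2 R' : ℕ), (∀ x, (Ch x).card = M1) ∧
      (∀ y, ∑' x, (if y ∈ Ch x then (1 : ℝ≥0∞) else 0) ≤ M2) ∧ 4 * M2 ≤ M1 ∧ M1 ≠ 0 ∧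
      ∀ x, ∀ y ∈ Ch x, wdist S x y ≤ R' := by
  have hδ := H.delta
  set D : ℕ := ⌈2 * (κ + δ) + 3 * δ⌉₊ + 1 with hD
  have hDb : 2 * (κ + δ) + 3 * δ < D := by
    rw [hD]; push_cast; exact (Nat.le_ceil _).trans_lt (by linarith)
  obtain ⟨a, ha1, ha2⟩ := h3 D
  set W : ℕ := ∑ i, wl S (a i) with hW
  have hWi : ∀ i, wl S (a i) ≤ W := fun i =>
    Finset.single_le_sum (f := fun i => wl S (a i)) (fun _ _ => Nat.zero_le _) (Finset.mem_univ i)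
  obtain ⟨Bn, hBn⟩ := mult_bound hS H (κ + δ + δ)
  set m := (2 * W + 1) * (4 * Bn) with hm
  set k := 2 * m with hk
  have hbig : 4 * ((k * W + 1) * Bn) ≤ 2 ^ k := by
    have l1 : m ≤ 2 ^ m := Nat.lt_two_pow_self.le
    have l2 : m + 1 ≤ 2 ^ m := Nat.lt_two_pow_self
    have l3 : k * W + 1 ≤ (2 * W + 1) * (m + 1) := by rw [hk]; nlinarith
    calc 4 * ((k * W + 1) * Bn) ≤ 4 * (((2 * W + 1) * (m + 1)) * Bn) := by gcongr
      _ = m * (m + 1) := by rw [hm]; ring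
      _ ≤ 2 ^ m * 2 ^ m := Nat.mul_le_mul l1 l2
      _ = 2 ^ k := by rw [hk, ← pow_add]; congr 1; ring
  have hcard := Dk_card H hκ ha1 hWi hDb ha2 k
  choose Ch hCh1 hCh2 using fun x => Finset.exists_subset_card_eq (hcard x)
  refine ⟨Ch, 2 ^ k, (k * W + 1) * Bn, k * W, hCh2, ?_, hbig, by positivity, ?_⟩
  · intro y
    obtain ⟨F, hF1, hF2⟩ := hBn (k * W) y
    have hz : ∀ x, x ∉ F → (if y ∈ Ch x then (1 : ℝ≥0∞) else 0) = 0 := by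
      intro x hx
      rw [if_neg]
      intro hy
      obtain ⟨g1, g2⟩ := Dk_geom H (by linarith) ha1 hWi hDb k x y (hCh1 x hy)
      exact hx (hF2 x g1 g2)
    rw [tsum_eq_sum hz]
    calc ∑ x ∈ F, (if y ∈ Ch x then (1 : ℝ≥0∞) else 0) ≤ ∑ x ∈ F, 1 :=
          Finset.sum_le_sum fun x _ => by split_ifs <;> simp
      _ = (F.card : ℝ≥0∞) := by simp
      _ ≤ _ := by exact_mod_cast hF1
  · intro x y hy
    exact (Dk_geom H (by linarith) ha1 hWi hDb k x y (hCh1 x hy)).2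

end Children

/-! ### The random walk and its lazy version -/

section RW
variable {Γ : Type} [Group Γ] {S : Set Γ} {δ : ℝ} {μ : Γ → ℝ}

/-- One step kernel. -/
noncomputable def Pk (μ : Γ → ℝ) : Ker Γ := fun x y => ENNReal.ofReal (μ (x⁻¹ * y))

/-- Lazy kernel. -/
noncomputable def Qk (μ : Γ → ℝ) : Ker Γ := fun x y => 2⁻¹ * ((1 : Ker Γ) x y + Pk μ x y)

theorem ptrans_nonneg (hμ : IsRWMeasure S μ) : ∀ n x y, 0 ≤ ptrans μ n x y := by
  intro n
  induction n with
  | zero => intro x y; simp only [ptrans]; split_ifs <;> norm_num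
  | succ n ih => intro x y; exact tsum_nonneg fun z => mul_nonneg (ih x z) (hμ.nonneg _)

theorem Pk_pow (hS : IsGenSet S) (hμ : IsRWMeasure S μ) :
    ∀ n x y, (Pk μ ^ n) x y = ENNReal.ofReal (ptrans μ n x y) := by
  intro n
  induction n with
  | zero =>
    intro x y
    rw [pow_zero, Ker.one_app]; simp only [ptrans]; split_ifs <;> simp
  | succ n ih =>
    intro x y
    rw [pow_succ, Ker.mul_app]
    simp only [ptrans]
    rw [ENNReal.ofReal_tsum_of_nonneg (fun z => mul_nonneg (ptrans_nonneg hμ n x z) (hμ.nonneg _))]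
    · refine tsum_congr fun z => ?_
      rw [ih, ENNReal.ofReal_mul (ptrans_nonneg hμ n x z)]; rfl
    · apply summable_of_finite_support
      refine (hS.1.image (fun s => y * s⁻¹)).subset fun z hz => ?_
      have h1 : μ (z⁻¹ * y) ≠ 0 := fun h => hz (by simp [h])
      exact ⟨z⁻¹ * y, hμ.support_subset _ h1, by group⟩

theorem green_eq (hS : IsGenSet S) (hμ : IsRWMeasure S μ) (x y : Γ) :
    green μ x y = (Ker.Gr (Pk μ) x y).toReal := by
  rw [Ker.Gr_app, ENNReal.tsum_toReal_eq (fun n => by rw [Pk_pow hS hμ]; exact ENNReal.ofReal_ne_top)]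
  refine tsum_congr fun n => ?_
  rw [Pk_pow hS hμ, ENNReal.toReal_ofReal (ptrans_nonneg hμ n x y)]

theorem Pk_row (hμ : IsRWMeasure S μ) (x : Γ) : ∑' y, Pk μ x y = 1 := by
  have hs : Summable μ := by
    by_contra h
    have := hμ.total
    rw [tsum_eq_zero_of_not_summable h] at this
    exact zero_ne_one this
  have h1 : ∑' y, Pk μ x y = ∑' g, ENNReal.ofReal (μ g) :=
    (Equiv.mulLeft x⁻¹).tsum_eq (fun g => ENNReal.ofReal (μ g))
  rw [h1, ← ENNReal.ofReal_tsum_of_nonneg hμ.nonneg hs, hμ.total, ENNReal.ofReal_one]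

/-- left invariant kernels -/
def Inv (p : Ker Γ) : Prop := ∀ g x y, p (g * x) (g * y) = p x y

theorem Inv.one : Inv (1 : Ker Γ) := by
  intro g x y
  rw [Ker.one_app, Ker.one_app]
  by_cases h : x = y
  · rw [if_pos h, if_pos (by rw [h])]
  · rw [if_neg h, if_neg (fun h' => h (mul_left_cancel h'))]

theorem Inv.mul {p q : Ker Γ} (hp : Inv p) (hq : Inv q) : Inv (p * q) := by
  intro g x y
  rw [Ker.mul_app, Ker.mul_app, ← (Equiv.mulLeft g).tsum_eq]
  refine tsum_congr fun z => ?_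
  simp only [Equiv.coe_mulLeft]
  rw [hp, hq]

theorem Inv.pow {p : Ker Γ} (hp : Inv p) (n : ℕ) : Inv (p ^ n) := by
  induction n with
  | zero => rw [pow_zero]; exact Inv.one
  | succ n ih => rw [pow_succ]; exact ih.mul hp

theorem Inv.col {p : Ker Γ} (hp : Inv p) (w : Γ) : ∑' x, p x w = ∑' y, p 1 y := by
  rw [← ((Equiv.inv Γ).trans (Equiv.mulRight w)).tsum_eq (fun y => p 1 y)]
  refine tsum_congr fun x => ?_
  simp only [Equiv.trans_apply, Equiv.inv_apply, Equiv.coe_mulRight]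
  have := hp x⁻¹ x w
  rw [inv_mul_cancel] at this
  exact this.symm

theorem Qk_inv : Inv (Qk μ) := by
  intro g x y
  have h : Pk μ (g * x) (g * y) = Pk μ x y := by simp only [Pk]; congr 2; group
  simp only [Qk]; rw [h, Inv.one g x y]

theorem row_one (x : Γ) : ∑' y, (1 : Ker Γ) x y = 1 := by
  classical
  simp [Ker.one_app]

theorem row_pow {p : Ker Γ} (hp : ∀ x, ∑' y, p x y = 1) : ∀ n x, ∑' y, (p ^ n) x y = 1 := by
  intro n
  induction n with
  | zero => intro x; rw [pow_zero]; exact row_one x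
  | succ n ih =>
    intro x
    simp only [pow_succ, Ker.mul_app]
    rw [ENNReal.tsum_comm]
    simp only [ENNReal.tsum_mul_left, hp, mul_one, ih]

theorem Qk_row (hμ : IsRWMeasure S μ) (x : Γ) : ∑' y, Qk μ x y = 1 := by
  simp only [Qk]
  rw [ENNReal.tsum_mul_left, ENNReal.tsum_add, row_one, Pk_row hμ, one_add_one_eq_two]
  exact ENNReal.inv_mul_cancel two_ne_zero ENNReal.ofNat_ne_top

theorem Qk_range (H : Hyp (wdist S) δ) (hμ : IsRWMeasure S μ) :
    ∀ n x y, (Qk μ ^ n) x y ≠ 0 → wdist S x y ≤ n := by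
  have h1 : ∀ x y, Qk μ x y ≠ 0 → wdist S x y ≤ 1 := by
    intro x y h
    by_cases hxy : x = y
    · subst hxy; rw [H.self]; omega
    · have : Pk μ x y ≠ 0 := by
        intro h0; apply h
        simp [Qk, h0, Ker.one_app, hxy]
      have : μ (x⁻¹ * y) ≠ 0 := by
        intro h0; apply this; simp [Pk, h0]
      exact wl_gen (hμ.support_subset _ this)
  intro n
  induction n with
  | zero =>
    intro x y h
    have : x = y := by
      by_contra hne; apply h; rw [pow_zero, Ker.one_app, if_neg hne]
    subst this; rw [H.self]
  | succ n ih =>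
    intro x y h
    rw [pow_succ] at h
    obtain ⟨z, h2, h3⟩ := Ker.mul_ne_zero' h
    have := ih x z h2
    have := h1 z y h3
    have := H.tri x z y
    omega

theorem Qk_diag (x : Γ) : Qk μ x x ≠ 0 := by
  simp [Qk, Ker.one_app]

theorem Qk_pow_mono {n m : ℕ} (hnm : n ≤ m) {x y : Γ} (h : (Qk μ ^ n) x y ≠ 0) : (Qk μ ^ m) x y ≠ 0 := by
  induction m, hnm using Nat.le_induction with
  | base => exact h
  | succ m _ ih =>
    rw [pow_succ]
    exact ((pos_iff_ne_zero.2 (mul_ne_zero ih (Qk_diag y))).trans_le (Ker.le_mul' _ _ x y y)).ne'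

theorem Qk_list (l : List Γ) : ∀ x, (∀ a ∈ l, 0 < μ a) → (Qk μ ^ l.length) x (x * l.prod) ≠ 0 := by
  induction l with
  | nil => intro x _; simp [Ker.one_app]
  | cons a l ih =>
    intro x h
    rw [List.length_cons, pow_succ', List.prod_cons]
    have h1 := ih (x * a) (fun b hb => h b (by simp [hb]))
    have h2 : Qk μ x (x * a) ≠ 0 := by
      have : 0 < μ a := h a (by simp)
      simp [Qk, Pk, this]
    rw [← mul_assoc]
    exact ((pos_iff_ne_zero.2 (mul_ne_zero h2 h1)).trans_le (Ker.le_mul' _ _ x _ (x * a))).ne'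

theorem exists_elliptic (hS : IsGenSet S) (hμ : IsRWMeasure S μ) (R0 : ℕ) :
    ∃ (N : ℕ) (c : ℝ≥0∞), 1 ≤ N ∧ c ≠ 0 ∧ c ≤ 1 ∧ ∀ x y, wdist S x y ≤ R0 → c ≤ (Qk μ ^ N) x y := by
  classical
  set Bf := (wl_ball_finite hS R0).toFinset with hBf
  choose l hl1 hl2 hl3 using hμ.nondeg
  set N := Bf.sup (fun g => (l g).length) + 1 with hN
  have hpos : ∀ g ∈ Bf, (Qk μ ^ N) 1 g ≠ 0 := by
    intro g hg
    have h1 := Qk_list (μ := μ) (l g) 1 (hl2 g)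
    rw [hl3, one_mul] at h1
    refine Qk_pow_mono ?_ h1
    have := Finset.le_sup (f := fun g => (l g).length) hg
    omega
  have hne : Bf.Nonempty := ⟨1, by rw [hBf, Set.Finite.mem_toFinset]; show wl S 1 ≤ R0; rw [wl_one]; omega⟩
  obtain ⟨g0, hg0, hmin⟩ := Finset.exists_min_image Bf (fun g => (Qk μ ^ N) 1 g) hne
  refine ⟨N, (Qk μ ^ N) 1 g0, by omega, hpos g0 hg0, ?_, ?_⟩
  · rw [← row_pow (Qk_row hμ) N 1]
    exact ENNReal.le_tsum (f := fun g => (Qk μ ^ N) 1 g) g0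
  · intro x y hxy
    have h1 := (Qk_inv (μ := μ)).pow N x⁻¹ x y
    rw [inv_mul_cancel] at h1
    rw [← h1]
    apply hmin
    rw [hBf, Set.Finite.mem_toFinset]; exact hxy

open Classical in
theorem exists_walk (hS : IsGenSet S) (H : Hyp (wdist S) δ) (hμ : IsRWMeasure S μ)
    (Ch : Γ → Finset Γ) (M1 M2 R' : ℕ) (hM1 : ∀ x, (Ch x).card = M1)
    (hM2 : ∀ y, ∑' x, (if y ∈ Ch x then (1 : ℝ≥0∞) else 0) ≤ M2) (hM : 4 * M2 ≤ M1) (hM0 : M1 ≠ 0)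
    (hR' : ∀ x, ∀ y ∈ Ch x, wdist S x y ≤ R') :
    ∃ (N : ℕ) (ρ c : ℝ≥0∞), 1 ≤ N ∧ ρ < 1 ∧ c ≠ 0 ∧ c ≤ 1 ∧ Walk (wdist S) N ρ c (Qk μ ^ N) := by
  obtain ⟨N, c, hN, hc, hc1, hlow⟩ := exists_elliptic hS hμ (max R' 1)
  have hrange := Qk_range H hμ N
  have hfin : ∀ x, {w | (Qk μ ^ N) x w ≠ 0}.Finite := by
    intro x
    refine ((wl_ball_finite hS N).image (fun h => x * h)).subset fun w hw => ?_
    exact ⟨x⁻¹ * w, hrange x w hw, by group⟩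
  obtain ⟨ρ, hρ, hdec⟩ := decay_abs (Qk μ ^ N) hfin (row_pow (Qk_row hμ) N)
    (fun w => by rw [(Qk_inv.pow N).col w]; exact row_pow (Qk_row hμ) N 1) Ch M1 M2 hM1 hM2 hM hM0 c hc
    (hc1.trans_lt ENNReal.one_lt_top).ne
    (fun x y hy => hlow x y ((hR' x y hy).trans (le_max_left _ _)))
  exact ⟨N, ρ, c, hN, hρ, hc, hc1, hrange, hdec, fun x w h => hlow x w (by rw [h]; exact le_max_right _ _)⟩

theorem Gr_comm (p q : Ker Γ) (h : p * q = q * p) : Ker.Gr p * q = q * Ker.Gr p := by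
  ext x y
  rw [Ker.Gr_mul, Ker.mul_Gr]
  refine tsum_congr fun n => ?_
  have : Commute p q := h
  rw [(this.pow_left n).eq]

/-- The transfer kernel. -/
noncomputable def Tk (μ : Γ → ℝ) (N : ℕ) : Ker Γ := ∑ i ∈ Finset.range N, Qk μ ^ i

theorem Gr_Qk (N : ℕ) (hN : 1 ≤ N) : Ker.Gr (Qk μ) = Tk μ N * Ker.Gr (Qk μ ^ N) := by
  set Q := Qk μ with hQ
  apply le_antisymm
  · apply Ker.Gr_le
    apply le_of_eq
    obtain ⟨m, rfl⟩ : ∃ m, N = m + 1 := ⟨N - 1, by omega⟩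
    have h1 : Q * Tk μ (m + 1) = ∑ i ∈ Finset.range m, Q ^ (i + 1) + Q ^ (m + 1) := by
      rw [Tk, Finset.mul_sum, Finset.sum_range_succ]
      simp only [← hQ, ← pow_succ']
    rw [← mul_assoc, h1, add_mul, add_left_comm, ← Ker.Gr_eq, Tk, Finset.sum_range_succ', add_mul,
      pow_zero, one_mul]
  · have hc : Tk μ N * Ker.Gr (Q ^ N) = Ker.Gr (Q ^ N) * Tk μ N := by
      refine (Gr_comm _ _ ?_).symm
      rw [Tk, Finset.mul_sum, Finset.sum_mul]
      refine Finset.sum_congr rfl fun i _ => ?_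
      rw [← hQ, ← pow_add, ← pow_add, add_comm]
    rw [hc]
    apply Ker.Gr_mul_le
    apply le_of_eq
    have : ∀ n, Tk μ n + Q ^ n * Ker.Gr Q = Ker.Gr Q := by
      intro n
      induction n with
      | zero => simp [Tk]
      | succ n ih =>
        conv_rhs => rw [← ih, Ker.Gr_eq Q]
        rw [Tk, Finset.sum_range_succ, ← hQ, mul_add, mul_one, pow_succ, mul_assoc, ← add_assoc]
        rfl
    exact this N

theorem Gr_Qk_ne_top (hμ : IsRWMeasure S μ) (N : ℕ) (hN : 1 ≤ N) {d : Γ → Γ → ℕ} {ρ c : ℝ≥0∞} (hρ : ρ < 1)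
    (W : Walk d N ρ c (Qk μ ^ N)) (x y : Γ) : Ker.Gr (Qk μ) x y ≠ ⊤ := by
  rw [Gr_Qk N hN, Ker.mul_app]
  have hK : (1 - ρ)⁻¹ ≠ ⊤ := ENNReal.inv_ne_top.2 (tsub_pos_of_lt hρ).ne'
  have h1 : ∑' w, Tk μ N x w * Ker.Gr (Qk μ ^ N) w y ≤ (∑' w, Tk μ N x w) * (1 - ρ)⁻¹ := by
    rw [← ENNReal.tsum_mul_right]
    exact ENNReal.tsum_le_tsum fun w => mul_le_mul' le_rfl (W.Gr_le w y)
  have h2 : ∑' w, Tk μ N x w = N := by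
    simp only [Tk, Ker.sum_app]
    rw [Summable.tsum_finsetSum (fun _ _ => ENNReal.summable)]
    simp [row_pow (Qk_row hμ)]
  rw [h2] at h1
  exact (h1.trans_lt (ENNReal.mul_lt_top (ENNReal.natCast_ne_top _).lt_top hK.lt_top)).ne

/-- scalar multiple of a kernel -/
noncomputable def ksmul (c : ℝ≥0∞) (p : Ker Γ) : Ker Γ := fun x y => c * p x y

theorem mul_ksmul (c : ℝ≥0∞) (p q : Ker Γ) (x y : Γ) : (p * ksmul c q) x y = c * (p * q) x y := by
  rw [Ker.mul_app, Ker.mul_app, ← ENNReal.tsum_mul_left]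
  refine tsum_congr fun z => ?_
  simp only [ksmul]; ring

theorem Gr_Pk (ht : ∀ x y, Ker.Gr (Qk μ) x y ≠ ⊤) (x y : Γ) :
    2 * Ker.Gr (Pk μ) x y = Ker.Gr (Qk μ) x y := by
  have half : (2 : ℝ≥0∞)⁻¹ * 2 = 1 := ENNReal.inv_mul_cancel two_ne_zero ENNReal.ofNat_ne_top
  have half' : (2 : ℝ≥0∞) * 2⁻¹ = 1 := by rw [mul_comm]; exact half
  have hQX : ∀ (X : Ker Γ) x y, (Qk μ * X) x y = 2⁻¹ * (X x y + (Pk μ * X) x y) := by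
    intro X x y
    have : ∀ z, Qk μ x z * X z y = 2⁻¹ * ((1 : Ker Γ) x z * X z y + Pk μ x z * X z y) := by
      intro z; simp only [Qk]; ring
    simp only [Ker.mul_app (Qk μ), this]
    rw [ENNReal.tsum_mul_left, ENNReal.tsum_add, ← Ker.mul_app, ← Ker.mul_app, one_mul]
  apply le_antisymm
  · have : Ker.Gr (Pk μ) ≤ ksmul 2⁻¹ (Ker.Gr (Qk μ)) := by
      apply Ker.Gr_le
      intro x y
      rw [Ker.add_app]
      rw [mul_ksmul]
      have h1 : Ker.Gr (Qk μ) x y = (1 : Ker Γ) x y + (2⁻¹ * Ker.Gr (Qk μ) x y + 2⁻¹ * (Pk μ * Ker.Gr (Qk μ)) x y) := by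
        conv_lhs => rw [Ker.Gr_eq, Ker.add_app, hQX, mul_add]
      have h2 : Ker.Gr (Qk μ) x y = 2⁻¹ * Ker.Gr (Qk μ) x y + 2⁻¹ * Ker.Gr (Qk μ) x y := by
        rw [← two_mul, ← mul_assoc, half', one_mul]
      have ht2 : 2⁻¹ * Ker.Gr (Qk μ) x y ≠ ⊤ := ENNReal.mul_ne_top (by simp) (ht x y)
      have h3 : 2⁻¹ * Ker.Gr (Qk μ) x y + ((1 : Ker Γ) x y + 2⁻¹ * (Pk μ * Ker.Gr (Qk μ)) x y) =
          2⁻¹ * Ker.Gr (Qk μ) x y + 2⁻¹ * Ker.Gr (Qk μ) x y := by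
        rw [← h2, add_left_comm]; exact h1.symm
      exact ((ENNReal.add_right_inj ht2).1 h3).le
    calc 2 * Ker.Gr (Pk μ) x y ≤ 2 * (2⁻¹ * Ker.Gr (Qk μ) x y) := by gcongr; exact this x y
      _ = _ := by rw [← mul_assoc, half', one_mul]
  · have : Ker.Gr (Qk μ) ≤ ksmul 2 (Ker.Gr (Pk μ)) := by
      apply Ker.Gr_le
      intro x y
      rw [Ker.add_app, hQX]
      rw [mul_ksmul]
      simp only [ksmul]
      rw [← mul_add, ← mul_assoc, half, one_mul, add_left_comm, ← Ker.add_app, ← Ker.Gr_eq, two_mul]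
    exact this x y

end RW

section Final
variable {Γ : Type} [Group Γ] {S : Set Γ} {δ : ℝ} {μ : Γ → ℝ}

theorem Tk_range (H : Hyp (wdist S) δ) (hμ : IsRWMeasure S μ) (N : ℕ) (x y : Γ)
    (h : Tk μ N x y ≠ 0) : wdist S x y ≤ N := by
  by_contra hlt
  apply h
  simp only [Tk, Ker.sum_app]
  refine Finset.sum_eq_zero fun i hi => ?_
  by_contra h0
  have := Qk_range H hμ i x y h0
  have := Finset.mem_range.1 hi
  omega

theorem tsum_mul_tsum' {V : Type} (a b : V → ℝ≥0∞) :
    (∑' w, a w) * (∑' w, b w) = ∑' w, ∑' w', a w * b w' := by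
  rw [← ENNReal.tsum_mul_right]
  exact tsum_congr fun w => ENNReal.tsum_mul_left.symm

theorem ratio_Q (H : Hyp (wdist S) δ) (hμ : IsRWMeasure S μ) {N : ℕ} (hN : 1 ≤ N) (x x' z z' : Γ)
    (C : ℝ≥0∞)
    (h : ∀ w w', wdist S x w ≤ N → wdist S x' w' ≤ N →
      Ker.Gr (Qk μ ^ N) w z * Ker.Gr (Qk μ ^ N) w' z' ≤
        C * (Ker.Gr (Qk μ ^ N) w z' * Ker.Gr (Qk μ ^ N) w' z)) :
    Ker.Gr (Qk μ) x z * Ker.Gr (Qk μ) x' z' ≤ C * (Ker.Gr (Qk μ) x z' * Ker.Gr (Qk μ) x' z) := by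
  rw [Gr_Qk N hN]
  simp only [Ker.mul_app (Tk μ N)]
  rw [tsum_mul_tsum', tsum_mul_tsum', ← ENNReal.tsum_mul_left]
  refine ENNReal.tsum_le_tsum fun w => ?_
  rw [← ENNReal.tsum_mul_left]
  refine ENNReal.tsum_le_tsum fun w' => ?_
  by_cases h1 : Tk μ N x w = 0
  · simp [h1]
  by_cases h2 : Tk μ N x' w' = 0
  · simp [h2]
  have h3 := h w w' (Tk_range H hμ N x w h1) (Tk_range H hμ N x' w' h2)
  calc _ = Tk μ N x w * Tk μ N x' w' *
        (Ker.Gr (Qk μ ^ N) w z * Ker.Gr (Qk μ ^ N) w' z') := by ring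
    _ ≤ Tk μ N x w * Tk μ N x' w' *
        (C * (Ker.Gr (Qk μ ^ N) w z' * Ker.Gr (Qk μ ^ N) w' z)) := mul_le_mul' le_rfl h3
    _ = _ := by ring

/-- real form of the decay estimate -/
theorem exp_bound (q : ℝ) (hq0 : 0 ≤ q) (hq1 : q < 1) (D : ℕ) :
    ∃ τ : ℝ, 0 < τ ∧ τ < 1 ∧ ∀ (f : Γ → ℝ) (s : Γ → Γ → ℝ) (A : ℕ) (M Bd : ℝ), 0 ≤ M → 0 ≤ Bd →
      (∀ z, 0 ≤ f z) → (∀ z, f z ≤ Bd) →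
      (∀ z z' (n : ℕ), ((2 * n * D + A : ℕ) : ℝ) ≤ s z z' → |f z - f z'| ≤ q ^ n * M) →
      ∃ Hc : ℝ, 0 ≤ Hc ∧ ∀ z z' (T : ℝ), T ≤ s z z' → |f z - f z'| ≤ Hc * τ ^ T := by
  set p := max q (1 / 2) with hp
  have hp0 : 0 < p := lt_of_lt_of_le (by norm_num) (le_max_right _ _)
  have hp1 : p < 1 := max_lt hq1 (by norm_num)
  have hD : (0 : ℝ) < 2 * D + 1 := by positivity
  refine ⟨p ^ ((2 * D + 1 : ℝ)⁻¹), Real.rpow_pos_of_pos hp0 _,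
    Real.rpow_lt_one hp0.le hp1 (inv_pos.2 hD), ?_⟩
  set τ := p ^ ((2 * D + 1 : ℝ)⁻¹) with hτ
  have hτ0 : 0 < τ := Real.rpow_pos_of_pos hp0 _
  have hτ1 : τ < 1 := Real.rpow_lt_one hp0.le hp1 (inv_pos.2 hD)
  intro f s A M Bd hM hBd hf0 hfB hs
  refine ⟨(M + Bd) * τ ^ (-(A + (2 * D + 1)) : ℝ), by positivity, ?_⟩
  intro z z' T hT
  rw [mul_assoc, ← Real.rpow_add hτ0]
  rcases le_or_gt T A with hTA | hTA
  · have h1 : 1 ≤ τ ^ (-(A + (2 * D + 1)) + T : ℝ) :=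
      Real.one_le_rpow_of_pos_of_le_one_of_nonpos hτ0 hτ1.le (by linarith)
    have h2 : |f z - f z'| ≤ Bd := by
      rw [abs_le]; constructor <;> linarith [hf0 z, hf0 z', hfB z, hfB z']
    nlinarith
  · set n := ⌊(T - A) / (2 * D + 1)⌋₊ with hn
    have h0 : 0 ≤ (T - A) / (2 * D + 1) := div_nonneg (by linarith) hD.le
    have hn1 : (n : ℝ) ≤ (T - A) / (2 * D + 1) := Nat.floor_le h0
    have hn2 : (T - A) / (2 * D + 1) < n + 1 := Nat.lt_floor_add_one _
    rw [le_div_iff₀ hD] at hn1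
    have h3 : ((2 * n * D + A : ℕ) : ℝ) ≤ s z z' := by
      push_cast
      have : (0 : ℝ) ≤ n := Nat.cast_nonneg _
      nlinarith
    have h4 := hs z z' n h3
    have h5 : q ^ n ≤ τ ^ (-(A + (2 * D + 1)) + T : ℝ) := by
      calc q ^ n ≤ p ^ n := pow_le_pow_left₀ hq0 (le_max_left _ _) n
        _ = p ^ (n : ℝ) := (Real.rpow_natCast _ _).symm
        _ ≤ p ^ ((2 * D + 1 : ℝ)⁻¹ * (-(A + (2 * D + 1)) + T)) := by
          apply Real.rpow_le_rpow_of_exponent_ge hp0 hp1.le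
          have : (2 * D + 1 : ℝ)⁻¹ * (-(A + (2 * D + 1)) + T) = (T - A) / (2 * D + 1) - 1 := by
            field_simp; ring
          linarith
        _ = _ := by rw [hτ, ← Real.rpow_mul hp0.le]
    have h6 : 0 ≤ τ ^ (-(A + (2 * D + 1)) + T : ℝ) := by positivity
    nlinarith [mul_nonneg hBd h6, mul_le_mul_of_nonneg_right h5 hM]

theorem boundary_bound (B : Boundary Γ S) (f : Γ → ℝ) (k : B.pt → ℝ)
    (hk : ∀ (ξ : B.pt) (u : ℕ → Γ), ConvInf S u → B.cls u = ξ →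
      Tendsto (fun n => f (u n)) atTop (𝓝 (k ξ)))
    (Bd : ℝ) (hBd : 0 ≤ Bd) (hf0 : ∀ z, 0 ≤ f z) (hfB : ∀ z, f z ≤ Bd)
    (τ : ℝ) (hτ0 : 0 < τ) (hτ1 : τ < 1) (Hc : ℝ) (hH : 0 ≤ Hc)
    (hf : ∀ z z' (T : ℝ), T ≤ gp S 1 z z' → |f z - f z'| ≤ Hc * τ ^ T) :
    ∃ H : ℝ, 0 ≤ H ∧ ∀ ξ η : B.pt, |k ξ - k η| ≤ H * τ ^ (bgpR B ξ η) := by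
  refine ⟨(Hc + Bd) * τ ^ (-1 : ℝ), by positivity, ?_⟩
  intro ξ η
  have hb : ∀ ξ, 0 ≤ k ξ ∧ k ξ ≤ Bd := by
    intro ξ
    obtain ⟨u, hu, hξ⟩ := B.cls_surj ξ
    have := hk ξ u hu hξ
    exact ⟨ge_of_tendsto' this fun n => hf0 _, le_of_tendsto' this fun n => hfB _⟩
  have h2 : |k ξ - k η| ≤ Bd := by
    rw [abs_le]; constructor <;> linarith [(hb ξ).1, (hb ξ).2, (hb η).1, (hb η).2]
  rw [mul_assoc, ← Real.rpow_add hτ0]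
  have small : bgpR B ξ η ≤ 1 → |k ξ - k η| ≤ (Hc + Bd) * τ ^ (-1 + bgpR B ξ η) := by
    intro h
    have h1 : 1 ≤ τ ^ (-1 + bgpR B ξ η) :=
      Real.one_le_rpow_of_pos_of_le_one_of_nonpos hτ0 hτ1.le (by linarith)
    nlinarith
  rcases le_or_gt (bgpR B ξ η) 1 with h1 | h1
  · exact small h1
  have htop : bgp B ξ η ≠ ⊤ := by
    intro h
    rw [bgpR, h] at h1
    norm_num at h1
  set T := -1 + bgpR B ξ η with hT
  have hlt : ENNReal.ofReal T < bgp B ξ η := by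
    rw [← ENNReal.ofReal_toReal htop]
    apply (ENNReal.ofReal_lt_ofReal_iff (by change 0 < bgpR B ξ η; linarith)).2
    change T < bgpR B ξ η
    linarith
  unfold bgp at hlt
  obtain ⟨⟨u, hu, hu'⟩, hlt⟩ := lt_iSup_iff.1 hlt
  obtain ⟨⟨v, hv, hv'⟩, hlt⟩ := lt_iSup_iff.1 hlt
  have hev := eventually_lt_of_lt_liminf hlt
  have hev2 : ∀ᶠ n in atTop, |f (u n) - f (v n)| ≤ Hc * τ ^ T := by
    have hdiag : Tendsto (fun n : ℕ => (n, n)) atTop atTop := by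
      rw [← prod_atTop_atTop_eq]; exact tendsto_id.prodMk tendsto_id
    filter_upwards [hdiag.eventually hev] with n hn
    apply hf
    exact ((ENNReal.ofReal_lt_ofReal_iff_of_nonneg (by linarith)).1 hn).le
  have hlim := ((hk ξ u hu hu').sub (hk η v hv hv')).abs
  have := le_of_tendsto hlim hev2
  have h6 : 0 ≤ τ ^ T := by positivity
  nlinarith [mul_nonneg hBd h6]

theorem finite_case (P : Type) [Finite P] (k : P → ℝ) (b : P → P → ℝ) :
    ∃ H : ℝ, 0 ≤ H ∧ ∀ ξ η, |k ξ - k η| ≤ H * (1 / 2 : ℝ) ^ b ξ η := by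
  classical
  haveI := Fintype.ofFinite P
  have hnn : ∀ p : P × P, 0 ≤ |k p.1 - k p.2| / (1 / 2 : ℝ) ^ b p.1 p.2 := fun p => by positivity
  refine ⟨∑ p : P × P, |k p.1 - k p.2| / (1 / 2 : ℝ) ^ b p.1 p.2,
    Finset.sum_nonneg fun p _ => hnn p, ?_⟩
  intro ξ η
  have h := Finset.single_le_sum (f := fun p : P × P => |k p.1 - k p.2| / (1 / 2 : ℝ) ^ b p.1 p.2)
    (fun p _ => hnn p) (Finset.mem_univ (ξ, η))
  have hp : (0 : ℝ) < (1 / 2 : ℝ) ^ b ξ η := by positivity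
  exact (div_le_iff₀ hp).1 h

theorem infinite_case (hS : IsGenSet S) (H : Hyp (wdist S) δ) (hμ : IsRWMeasure S μ)
    (B : Boundary Γ S) [Infinite B.pt] :
    ∃ τ : ℝ, 0 < τ ∧ τ < 1 ∧ ∀ g : Γ, ∃ Bd Hc : ℝ, 0 ≤ Bd ∧ 0 ≤ Hc ∧
      (∀ z, 0 ≤ martinK μ g z) ∧ (∀ z, martinK μ g z ≤ Bd) ∧
      ∀ z z' (T : ℝ), T ≤ gp S 1 z z' → |martinK μ g z - martinK μ g z'| ≤ Hc * τ ^ T := by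
  obtain ⟨κ, hκ, h3⟩ := exists_triple H B (fun i => Infinite.natEmbedding B.pt i)
    (fun i j h => Fin.ext ((Infinite.natEmbedding B.pt).injective h))
  obtain ⟨Ch, M1, M2, R', hM1, hM2, hM, hM0, hR'⟩ := exists_children hS H hκ h3
  obtain ⟨N, ρ, c, hN, hρ, hc, hc1, W⟩ := exists_walk hS H hμ Ch M1 M2 R' hM1 hM2 hM hM0 hR'
  obtain ⟨q, M, D, L, hq, hM, hh⟩ := holder_abs H (N := N) hρ hc hc1 (wdist_zero hS)
  have hqt : q ≠ ⊤ := hq.ne_top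
  have ht : ∀ x y, Ker.Gr (Qk μ) x y ≠ ⊤ := Gr_Qk_ne_top hμ N hN hρ W
  have hpos : ∀ x y, Ker.Gr (Qk μ) x y ≠ 0 := by
    intro x y
    obtain ⟨l, -, hl, hprod⟩ := hμ.nondeg (x⁻¹ * y)
    have h := Qk_list l x hl
    rw [hprod, mul_inv_cancel_left] at h
    exact fun h0 => h (le_antisymm ((Ker.pow_le_Gr _ _ x y).trans h0.le) bot_le)
  have hg : ∀ x y, green μ x y = (Ker.Gr (Qk μ) x y).toReal / 2 := by
    intro x y
    rw [green_eq hS hμ, ← Gr_Pk ht, ENNReal.toReal_mul]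
    simp
  have hGpos : ∀ x y, 0 < (Ker.Gr (Qk μ) x y).toReal := fun x y =>
    ENNReal.toReal_pos (hpos x y) (ht x y)
  set G : Γ → Γ → ℝ := fun x y => (Ker.Gr (Qk μ) x y).toReal with hG
  have hK : ∀ g z, martinK μ g z = G g z / G 1 z := by
    intro g z
    rw [martinK, hg, hg, div_div_div_cancel_right₀ two_ne_zero]
  obtain ⟨τ, hτ0, hτ1, hτ⟩ := exp_bound (Γ := Γ) q.toReal ENNReal.toReal_nonneg
    (by rw [← ENNReal.toReal_one]; exact (ENNReal.toReal_lt_toReal hqt ENNReal.one_ne_top).2 hq) D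
  refine ⟨τ, hτ0, hτ1, fun g => ?_⟩
  have hK0 : ∀ z, 0 ≤ martinK μ g z := fun z => by
    rw [hK]; exact (div_pos (hGpos _ _) (hGpos _ _)).le
  set Bd := G g g / G 1 g with hBd
  have hBd0 : 0 ≤ Bd := (div_pos (hGpos _ _) (hGpos _ _)).le
  have hKB : ∀ z, martinK μ g z ≤ Bd := by
    intro z
    rw [hK, hBd, div_le_div_iff₀ (hGpos _ _) (hGpos _ _)]
    have h := Ker.Gr_mul_Gr_le (Qk μ) 1 g z
    have h' := ENNReal.toReal_mono (ENNReal.mul_ne_top (ht _ _) (ht _ _)) h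
    rw [ENNReal.toReal_mul, ENNReal.toReal_mul] at h'
    simp only [hG]; linarith
  have key : ∀ z z' (n : ℕ), ((2 * n * D + ((wl S g + N) * D + L) : ℕ) : ℝ) ≤ gp S 1 z z' →
      ∀ x x', (x = g ∨ x = 1) → (x' = g ∨ x' = 1) →
      G x z * G x' z' ≤ (1 + q.toReal ^ n * M.toReal) * (G x z' * G x' z) := by
    intro z z' n hn x x' hx hx'
    have hr : ∀ x, (x = g ∨ x = 1) → ∀ w, wdist S x w ≤ N → wdist S 1 w ≤ wl S g + N := by
      intro x hx w hw
      have h1 : wdist S 1 x ≤ wl S g := by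
        rcases hx with rfl | rfl
        · rw [wdist_one]
        · rw [H.self]; exact Nat.zero_le _
      have := H.tri 1 x w
      omega
    have h := ratio_Q H hμ hN x x' z z' (1 + q ^ n * M) (fun w w' hw hw' =>
      hh _ W 1 z z' (wl S g + N) n (by
        have e : (2 * n + (wl S g + N)) * D + L = 2 * n * D + ((wl S g + N) * D + L) := by ring
        rw [e]; exact hn) w w' (hr x hx w hw) (hr x' hx' w' hw'))
    have hqM : q ^ n * M ≠ ⊤ := ENNReal.mul_ne_top (ENNReal.pow_ne_top hqt) hM
    have h' := ENNReal.toReal_mono (ENNReal.mul_ne_top (ENNReal.add_ne_top.2 ⟨ENNReal.one_ne_top, hqM⟩)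
      (ENNReal.mul_ne_top (ht _ _) (ht _ _))) h
    rw [ENNReal.toReal_mul, ENNReal.toReal_mul, ENNReal.toReal_mul,
      ENNReal.toReal_add ENNReal.one_ne_top hqM, ENNReal.toReal_mul, ENNReal.toReal_pow,
      ENNReal.toReal_one] at h'
    exact h'
  obtain ⟨Hc, hHc, hfin⟩ := hτ (martinK μ g) (gp S 1) ((wl S g + N) * D + L) (M.toReal * Bd) Bd
    (mul_nonneg ENNReal.toReal_nonneg hBd0) hBd0 hK0 hKB (by
      intro z z' n hn
      have k1 := key z z' n hn g 1 (Or.inl rfl) (Or.inr rfl)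
      have k2 := key z z' n hn 1 g (Or.inr rfl) (Or.inl rfl)
      set ε := q.toReal ^ n * M.toReal with hε
      have hε0 : 0 ≤ ε := by positivity
      have a1 : martinK μ g z ≤ (1 + ε) * martinK μ g z' := by
        rw [hK, hK, ← mul_div_assoc, div_le_div_iff₀ (hGpos _ _) (hGpos _ _)]
        linarith
      have a2 : martinK μ g z' ≤ (1 + ε) * martinK μ g z := by
        rw [hK, hK, ← mul_div_assoc, div_le_div_iff₀ (hGpos _ _) (hGpos _ _)]
        linarith
      have b1 := mul_le_mul_of_nonneg_left (hKB z) hε0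
      have b2 := mul_le_mul_of_nonneg_left (hKB z') hε0
      rw [← mul_assoc, ← hε, abs_le]
      constructor <;> linarith)
  exact ⟨Bd, Hc, hBd0, hHc, hK0, hKB, hfin⟩

end Final

theorem martin_kernel_holder
    (Γ : Type) [Group Γ] (S : Set Γ) (δ : ℝ)
    (hS : IsGenSet S) (hδ : IsHyperbolic S δ) (hne : Nonelementary Γ)
    (μ : Γ → ℝ) (hμ : IsRWMeasure S μ)
    (B : Boundary Γ S)
    (Kb : Γ → B.pt → ℝ)
    (hKb : ∀ (x : Γ) (ξ : B.pt) (u : ℕ → Γ), ConvInf S u → B.cls u = ξ →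
      Tendsto (fun n => martinK μ x (u n)) atTop (𝓝 (Kb x ξ))) :
    ∃ τ : ℝ, 0 ≤ τ ∧ τ < 1 ∧ ∀ g : Γ, ∃ H : ℝ, 0 ≤ H ∧
      ∀ ξ η : B.pt, |Kb g ξ - Kb g η| ≤ H * τ ^ (bgpR B ξ η) := by
  have H := hyp_word hS hδ
  cases finite_or_infinite B.pt with
  | inl h =>
    exact ⟨1 / 2, by norm_num, by norm_num, fun g => finite_case B.pt (Kb g) (bgpR B)⟩
  | inr h =>
    obtain ⟨τ, hτ0, hτ1, hτ⟩ := infinite_case hS H hμ B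
    refine ⟨τ, hτ0.le, hτ1, fun g => ?_⟩
    obtain ⟨Bd, Hc, hBd, hHc, h0, hB, hf⟩ := hτ g
    exact boundary_bound B (martinK μ g) (Kb g) (hKb g) Bd hBd h0 hB τ hτ0 hτ1 Hc hHc hf

end HarmonicBoundary
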